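/- Let p be a prime and F a field of characteristic p that is p-cyclic reducible. Let A be a central simple F-algebra with exp A = p and ind A = p^n for a positive integer n. Then λ_p(A) ≤ 2·p^{n−1} − 1. -/

import Mathlib

open scoped TensorProduct

/-- A finite-dimensional central simple algebra over a field `F`. -/
def IsCSA (F A : Type) [Field F] [Ring A] [Algebra F A] : Prop :=
  Algebra.IsCentral F A ∧ IsSimpleRing A ∧ FiniteDimensional F A

/-- An `F`-algebra is split if it is isomorphic to a matrix algebra over `F`. -/
def IsSplitAlg (F A : Type) [Field F] [Ring A] [Algebra F A] : Prop :=
  ∃ n : ℕ, 0 < n ∧ Nonempty (A ≃ₐ[F] Matrix (Fin n) (Fin n) F)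

/-- Brauer equivalence of two algebras over a field `F`. -/
def IsBrauerEquiv (F A B : Type) [Field F] [Ring A] [Algebra F A] [Ring B] [Algebra F B] :
    Prop :=
  ∃ n m : ℕ, 0 < n ∧ 0 < m ∧
    Nonempty ((Matrix (Fin n) (Fin n) A) ≃ₐ[F] (Matrix (Fin m) (Fin m) B))

/-- `A` has exponent `e`: `e` is the least positive integer such that the `e`-fold tensor
power of `A` over `F` is split. -/
def HasExponent (F A : Type) [Field F] [Ring A] [Algebra F A] (e : ℕ) : Prop :=
  0 < e ∧ IsSplitAlg F (⨂[F] _ : Fin e, A) ∧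
    ∀ k : ℕ, 0 < k → IsSplitAlg F (⨂[F] _ : Fin k, A) → e ≤ k

/-- `A` has (Schur) index `d`: `A` is isomorphic to a matrix algebra over a division
algebra of dimension `d ^ 2` over `F`. -/
def HasIndex (F A : Type) [Field F] [Ring A] [Algebra F A] (d : ℕ) : Prop :=
  ∃ (D : Type) (_ : DivisionRing D) (_ : Algebra F D) (m : ℕ), 0 < m ∧
    Nonempty (A ≃ₐ[F] Matrix (Fin m) (Fin m) D) ∧ Module.finrank F D = d ^ 2

/-- The (Schur) index of `A` is at most `d`. -/
def IndexLE (F A : Type) [Field F] [Ring A] [Algebra F A] (d : ℕ) : Prop :=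
  ∃ e : ℕ, e ≤ d ∧ HasIndex F A e

/-- `A` is the cyclic (symbol) algebra `[a, b)_{p,F}` of degree `p` in characteristic `p`:
it has dimension `p ^ 2` over `F` and is generated by elements `i`, `j` subject to
`i ^ p - i = a`, `j ^ p = b`, `j * i = (i - 1) * j`. -/
def IsCyclicAlgWith (p : ℕ) (F A : Type) [Field F] [Ring A] [Algebra F A] (a b : F) : Prop :=
  b ≠ 0 ∧ Module.finrank F A = p ^ 2 ∧
    ∃ i j : A, i ^ p - i = algebraMap F A a ∧ j ^ p = algebraMap F A b ∧
      j * i = (i - 1) * j ∧ Algebra.adjoin F {i, j} = ⊤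

/-- `A` is a cyclic algebra of degree `p`, i.e. of the form `[a, b)_{p,F}`. -/
def IsCyclicPAlg (p : ℕ) (F A : Type) [Field F] [Ring A] [Algebra F A] : Prop :=
  ∃ a b : F, IsCyclicAlgWith p F A a b

/-- The `p`-symbol length of `A` is at most `m`: `A` is Brauer equivalent to a tensor
product of at most `m` cyclic `F`-algebras of degree `p`. -/
def SymbolLengthLE (p : ℕ) (F A : Type) [Field F] [Ring A] [Algebra F A] (m : ℕ) : Prop :=
  ∃ k : ℕ, k ≤ m ∧ ∃ (D : Fin k → Type) (_ : ∀ i, Ring (D i)) (_ : ∀ i, Algebra F (D i)),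
    (∀ i, IsCyclicPAlg p F (D i)) ∧ IsBrauerEquiv F A (⨂[F] i, D i)

/-- `M` is a compositum `LK` of `L` and `K` over `F`: it is generated as an `F`-algebra by
the images of `L` and `K`. -/
def IsCompositum (F L K M : Type) [Field F] [Field L] [Field K] [Field M]
    [Algebra F L] [Algebra F K] [Algebra F M] [Algebra L M] [Algebra K M]
    [IsScalarTower F L M] [IsScalarTower F K M] : Prop :=
  (IsScalarTower.toAlgHom F L M).range ⊔ (IsScalarTower.toAlgHom F K M).range = ⊤

/-- A cyclic algebra of degree `m` over `F`: a central simple `F`-algebra of degree `m`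
containing a cyclic field extension of `F` of degree `m` (as a maximal subfield). -/
def IsCyclicAlgebra (F A : Type) [Field F] [Ring A] [Algebra F A] (m : ℕ) : Prop :=
  IsCSA F A ∧ Module.finrank F A = m ^ 2 ∧
  ∃ (L : Type) (_ : Field L) (_ : Algebra F L), IsGalois F L ∧ IsCyclic (L ≃ₐ[F] L) ∧
    Module.finrank F L = m ∧ Nonempty (L →ₐ[F] A)

/-- `L/F` is a `p`-extension: there is a tower of intermediate fields from `F` to `L`
each step of which is a cyclic extension of degree `p`. -/
def IsPExtension (p : ℕ) (F L : Type) [Field F] [Field L] [Algebra F L] : Prop :=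
  ∃ (n : ℕ) (T : Fin (n + 1) → IntermediateField F L),
    T 0 = ⊥ ∧ T (Fin.last n) = ⊤ ∧
    ∀ i : Fin n, ∃ h : T i.castSucc ≤ T i.succ,
      IsGalois (T i.castSucc) (IntermediateField.extendScalars h) ∧
      IsCyclic ((IntermediateField.extendScalars h) ≃ₐ[T i.castSucc]
        (IntermediateField.extendScalars h)) ∧
      Module.finrank (T i.castSucc) (IntermediateField.extendScalars h) = p

/-- `F` is `p`-cyclic reducible: for every central simple `F`-algebra `A` of exponent `p`
and every purely inseparable extension `K/F` with `K ^ p ⊆ F`, either `A_K` is split, or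
there is a separable extension `L/F` of degree `ind (A_K) / p` such that `A_{LK}` is
Brauer equivalent to a cyclic `LK`-algebra of degree `p`. -/
def IsPCyclicReducible (p : ℕ) (F : Type) [Field F] : Prop :=
  ∀ (A : Type) [Ring A] [Algebra F A], IsCSA F A → HasExponent F A p →
  ∀ (K : Type) [Field K] [Algebra F K], IsPurelyInseparable F K →
    (∀ z : K, z ^ p ∈ (algebraMap F K).range) →
    IsSplitAlg K (K ⊗[F] A) ∨
    ∃ d : ℕ, HasIndex K (K ⊗[F] A) (p * d) ∧
      ∃ (L : Type) (_ : Field L) (_ : Algebra F L), Algebra.IsSeparable F L ∧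
        Module.finrank F L = d ∧
        ∃ (M : Type) (_ : Field M) (_ : Algebra F M) (_ : Algebra L M) (_ : Algebra K M)
          (_ : IsScalarTower F L M) (_ : IsScalarTower F K M),
          IsCompositum F L K M ∧
          ∃ (C : Type) (_ : Ring C) (_ : Algebra M C),
            IsCyclicPAlg p M C ∧ IsBrauerEquiv M (M ⊗[F] A) C

/-- `F` is `p`-reducible: for every central simple `F`-algebra `A` of exponent `p`
and every purely inseparable extension `K/F` with `K ^ p ⊆ F`, either `A_K` is split, or
there is a separable extension `L/F` of degree `ind (A_K) / p` with `ind A_{LK} = p`. -/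
def IsPReducible (p : ℕ) (F : Type) [Field F] : Prop :=
  ∀ (A : Type) [Ring A] [Algebra F A], IsCSA F A → HasExponent F A p →
  ∀ (K : Type) [Field K] [Algebra F K], IsPurelyInseparable F K →
    (∀ z : K, z ^ p ∈ (algebraMap F K).range) →
    IsSplitAlg K (K ⊗[F] A) ∨
    ∃ d : ℕ, HasIndex K (K ⊗[F] A) (p * d) ∧
      ∃ (L : Type) (_ : Field L) (_ : Algebra F L), Algebra.IsSeparable F L ∧
        Module.finrank F L = d ∧
        ∃ (M : Type) (_ : Field M) (_ : Algebra F M) (_ : Algebra L M) (_ : Algebra K M)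
          (_ : IsScalarTower F L M) (_ : IsScalarTower F K M),
          IsCompositum F L K M ∧ HasIndex M (M ⊗[F] A) p
section CentralSimple

variable {F A B : Type} [Field F] [Ring A] [Algebra F A] [Ring B] [Algebra F B]

theorem Subalgebra.eq_top_of_isSimpleModule {V : Type} [AddCommGroup V] [Module F V]
    [FiniteDimensional F V] (S : Subalgebra F (Module.End F V)) [IsSimpleModule S V]
    (h : ∀ g : Module.End S V, ∃ c : F, ∀ v, g v = c • v) : S = ⊤ := by
  refine eq_top_iff.2 fun f _ => ?_
  obtain ⟨s, hs⟩ := Module.Finite.fg_top (R := F) (M := V)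
  let f' : Module.End (Module.End S V) V :=
    { toFun := f
      map_add' := f.map_add
      map_smul' := fun g v => by
        obtain ⟨c, hc⟩ := h g
        simp [hc] }
  obtain ⟨r, hr⟩ := jacobson_density f' s
  have : f = (r : Module.End F V) := LinearMap.ext_on hs fun v hv => hr v hv
  exact this ▸ r.2

theorem IsCSA.mulLeftRight_surjective (hA : IsCSA F A) :
    Function.Surjective (AlgHom.mulLeftRight F A) := by
  obtain ⟨hc, hs, hf⟩ := hA
  set S := (AlgHom.mulLeftRight F A).range with hS
  have hmem : ∀ a b : A, ∃ s : S, ∀ x, s • x = a * x * b := fun a b =>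
    ⟨⟨_, a ⊗ₜ MulOpposite.op b, rfl⟩, fun x => AlgHom.mulLeftRight_apply F A a (.op b) x⟩
  have : IsSimpleModule S A := by
    refine isSimpleModule_iff_toSpanSingleton_surjective.2 ⟨inferInstance, fun x hx => ?_⟩
    have h1 : (1 : A) ∈ TwoSidedIdeal.span {x} :=
      IsSimpleRing.one_mem_of_ne_zero_mem _ hx (TwoSidedIdeal.subset_span rfl)
    have key : ∀ y ∈ TwoSidedIdeal.span {x}, y ∈ Submodule.span S {x} := by
      intro y hy
      rw [TwoSidedIdeal.mem_span_iff_mem_addSubgroup_closure] at hy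
      induction hy using AddSubgroup.closure_induction with
      | mem z hz =>
        obtain ⟨a, ⟨a', -, b', hb, rfl⟩, c, -, rfl⟩ := hz
        obtain ⟨s, hs⟩ := hmem a' c
        rw [Set.mem_singleton_iff] at hb
        subst hb
        have := hs b'
        simp only [] at this ⊢
        exact this ▸ Submodule.smul_mem _ s (Submodule.mem_span_singleton_self _)
      | zero => exact zero_mem _
      | add _ _ _ _ h h' => exact add_mem h h'
      | neg z _ h =>
        obtain ⟨s, hs⟩ := hmem (-1) 1
        have := Submodule.smul_mem _ s h
        rwa [hs, neg_one_mul, mul_one] at this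
    intro y
    obtain ⟨s, hs⟩ := hmem y 1
    have h2 : y ∈ Submodule.span S {x} := by
      have := Submodule.smul_mem _ s (key _ h1)
      rwa [hs, mul_one, mul_one] at this
    obtain ⟨t, ht⟩ := Submodule.mem_span_singleton.1 h2
    exact ⟨t, ht⟩
  have htop : S = ⊤ := by
    refine Subalgebra.eq_top_of_isSimpleModule S fun g => ?_
    have hl : ∀ y, g y = y * g 1 := fun y => by
      obtain ⟨s, hs⟩ := hmem y 1
      have := g.map_smul s 1
      rwa [hs, hs, mul_one, mul_one, mul_one] at this
    have hr : ∀ y, g y = g 1 * y := fun y => by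
      obtain ⟨s, hs⟩ := hmem 1 y
      have := g.map_smul s 1
      rwa [hs, hs, one_mul, one_mul, one_mul] at this
    have : g 1 ∈ Subalgebra.center F A :=
      Subalgebra.mem_center_iff.2 fun y => (hl y).symm.trans (hr y)
    obtain ⟨c, hc'⟩ := Algebra.mem_bot.1 (hc.out this)
    exact ⟨c, fun v => by rw [hr, ← hc', Algebra.smul_def]⟩
  exact (AlgHom.range_eq_top _).1 htop

theorem IsCSA.exists_mulLeftRight_eq (hA : IsCSA F A) (f : A →ₗ[F] F) :
    ∃ t : A ⊗[F] Aᵐᵒᵖ, ∀ x, AlgHom.mulLeftRight F A t x = algebraMap F A (f x) := by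
  obtain ⟨t, ht⟩ := hA.mulLeftRight_surjective ((Algebra.linearMap F A).comp f)
  exact ⟨t, fun x => by rw [ht]; rfl⟩

/-- Applying a functional to the left factor. -/
noncomputable def tensorContractLeft (B : Type) [Ring B] [Algebra F B] (f : A →ₗ[F] F) :
    A ⊗[F] B →ₗ[F] B :=
  (TensorProduct.lid F B).toLinearMap.comp (f.rTensor B)

@[simp]
theorem tensorContractLeft_tmul (f : A →ₗ[F] F) (a : A) (b : B) :
    tensorContractLeft B f (a ⊗ₜ b) = f a • b := by
  simp [tensorContractLeft]

theorem exists_tensorContractLeft_ne_zero {x : A ⊗[F] B} (hx : x ≠ 0) :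
    ∃ f : A →ₗ[F] F, tensorContractLeft B f x ≠ 0 := by
  classical
  let b := Module.Free.chooseBasis F A
  by_contra! h
  apply hx
  apply (TensorProduct.equivFinsuppOfBasisLeft b (N := B)).injective
  ext i
  have : ∀ y : A ⊗[F] B,
      TensorProduct.equivFinsuppOfBasisLeft b y i = tensorContractLeft B (b.coord i) y := by
    intro y
    induction y using TensorProduct.induction_on with
    | zero => simp
    | tmul a c => simp
    | add y z hy hz => simp [hy, hz]
  rw [this, h]
  simp

theorem IsCSA.one_tmul_tensorContractLeft (hA : IsCSA F A) (f : A →ₗ[F] F) (x : A ⊗[F] B) :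
    ∃ s : Finset (A × Aᵐᵒᵖ), (1 : A) ⊗ₜ[F] tensorContractLeft B f x =
      ∑ u ∈ s, (u.1 ⊗ₜ[F] (1 : B)) * x * (u.2.unop ⊗ₜ[F] (1 : B)) ∧
      ∑ u ∈ s, u.1 * u.2.unop = algebraMap F A (f 1) := by
  obtain ⟨t, ht⟩ := hA.exists_mulLeftRight_eq f
  obtain ⟨s, rfl⟩ := TensorProduct.exists_finset t
  refine ⟨s, ?_, ?_⟩
  · induction x using TensorProduct.induction_on with
    | zero => simp
    | tmul a b =>
      have := ht a
      simp only [map_sum, LinearMap.sum_apply, AlgHom.mulLeftRight_apply] at this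
      simp only [tensorContractLeft_tmul, Algebra.TensorProduct.tmul_mul_tmul, one_mul, mul_one,
        ← TensorProduct.sum_tmul, this, TensorProduct.tmul_smul, TensorProduct.smul_tmul',
        Algebra.algebraMap_eq_smul_one]
    | add y z hy hz =>
      simp only [map_add, TensorProduct.tmul_add, hy, hz, mul_add, add_mul,
        Finset.sum_add_distrib]
  · have := ht 1
    simpa only [map_sum, LinearMap.sum_apply, AlgHom.mulLeftRight_apply, mul_one] using this

theorem IsCSA.isSimpleRing_tensorProduct (hA : IsCSA F A) [IsSimpleRing B] :
    IsSimpleRing (A ⊗[F] B) := by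
  have := hA.2.1
  refine .of_eq_bot_or_eq_top fun J => or_iff_not_imp_left.2 fun hJ => ?_
  obtain ⟨x, hxJ, hx : x ≠ 0⟩ := SetLike.exists_of_lt (bot_lt_iff_ne_bot.mpr hJ)
  obtain ⟨f, hf⟩ := exists_tensorContractLeft_ne_zero hx
  obtain ⟨s, hs, -⟩ := hA.one_tmul_tensorContractLeft f x
  have h1 : (1 : A) ⊗ₜ[F] tensorContractLeft B f x ∈ J := by
    rw [hs]
    exact sum_mem fun u _ => J.mul_mem_right _ _ (J.mul_mem_left _ _ hxJ)
  let g := (Algebra.TensorProduct.includeRight : B →ₐ[F] A ⊗[F] B)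
  have h2 : (1 : B) ∈ J.comap g.toRingHom :=
    IsSimpleRing.one_mem_of_ne_zero_mem _ hf ((TwoSidedIdeal.mem_comap _).2 h1)
  rw [TwoSidedIdeal.mem_comap, map_one] at h2
  exact J.one_mem_iff.1 h2

theorem IsCSA.tensorProduct (hA : IsCSA F A) (hB : IsCSA F B) : IsCSA F (A ⊗[F] B) := by
  have := hA.2.1
  have := hA.2.2
  have := hB.2.1
  have := hB.2.2
  refine ⟨⟨fun x hx => ?_⟩, hA.isSimpleRing_tensorProduct, inferInstance⟩
  rw [Subalgebra.mem_center_iff] at hx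
  obtain ⟨f, hf⟩ := Module.Projective.exists_dual_ne_zero F (one_ne_zero (α := A))
  obtain ⟨s, hs, hs'⟩ := hA.one_tmul_tensorContractLeft ((f 1)⁻¹ • f) x
  have hx1 : (1 : A) ⊗ₜ[F] tensorContractLeft B ((f 1)⁻¹ • f) x = x := by
    rw [hs]
    simp_rw [hx, mul_assoc, Algebra.TensorProduct.tmul_mul_tmul, one_mul]
    rw [← Finset.mul_sum, ← TensorProduct.sum_tmul, hs', LinearMap.smul_apply, smul_eq_mul,
      inv_mul_cancel₀ hf, map_one]
    exact mul_one x
  set b := tensorContractLeft B ((f 1)⁻¹ • f) x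
  have hinj := Algebra.TensorProduct.includeRight_injective (R := F) (A := A) (B := B)
    (algebraMap F A).injective
  have hb : b ∈ Subalgebra.center F B := by
    refine Subalgebra.mem_center_iff.2 fun c => hinj ?_
    simpa [← hx1] using hx (1 ⊗ₜ c)
  obtain ⟨c, hc⟩ := Algebra.mem_bot.1 (hB.1.out hb)
  refine Algebra.mem_bot.2 ⟨c, ?_⟩
  rw [← hx1, ← hc, Algebra.TensorProduct.algebraMap_apply, Algebra.algebraMap_eq_smul_one,
    Algebra.algebraMap_eq_smul_one, TensorProduct.smul_tmul]

theorem IsCSA.congr (hA : IsCSA F A) (e : A ≃ₐ[F] B) : IsCSA F B :=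
  ⟨have := hA.1; .of_algEquiv F _ _ e, have := hA.2.1; .of_ringEquiv e.toRingEquiv this,
    have := hA.2.2; .of_injective e.symm.toLinearMap e.symm.injective⟩

end CentralSimple

section SplitsOver

variable {F A : Type} [Field F] [Ring A] [Algebra F A]

/-- The `E`-algebra homomorphism `E ⊗[F] A → S` induced by `A → S`. -/
noncomputable def baseChangeLift (E : Type) {S : Type} [Field E] [Algebra F E] [Ring S]
    [Algebra F S] [Algebra E S] [IsScalarTower F E S] (ρ : A →ₐ[F] S) : E ⊗[F] A →ₐ[E] S :=
  Algebra.TensorProduct.lift (Algebra.ofId E S) ρ fun x y => by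
    rw [Algebra.ofId_apply]; exact Algebra.commutes x (ρ y)

section

variable {E S : Type} [Field E] [Algebra F E] [Ring S]
    [Algebra F S] [Algebra E S] [IsScalarTower F E S]

@[simp]
theorem baseChangeLift_tmul (ρ : A →ₐ[F] S) (x : E) (a : A) :
    baseChangeLift E ρ (x ⊗ₜ a) = x • ρ a := by
  rw [baseChangeLift, Algebra.TensorProduct.lift_tmul, Algebra.smul_def, Algebra.ofId_apply]

theorem IsCSA.isSimpleRing_baseChange (hA : IsCSA F A) (E : Type) [Field E] [Algebra F E] :
    IsSimpleRing (E ⊗[F] A) :=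
  .of_ringEquiv (Algebra.TensorProduct.comm F A E).toRingEquiv hA.isSimpleRing_tensorProduct

theorem IsCSA.baseChangeLift_injective (hA : IsCSA F A) [Nontrivial S] (ρ : A →ₐ[F] S) :
    Function.Injective (baseChangeLift E ρ) :=
  have := hA.isSimpleRing_baseChange E
  (baseChangeLift E ρ).toRingHom.injective

theorem IsCSA.finrank_le (hA : IsCSA F A) (E : Type) {S : Type} [Field E] [Algebra F E] [Ring S]
    [Algebra F S] [Algebra E S] [IsScalarTower F E S] [Nontrivial S] [FiniteDimensional E S]
    (ρ : A →ₐ[F] S) :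
    Module.finrank F A ≤ Module.finrank E S := by
  have := LinearMap.finrank_le_finrank_of_injective (f := (baseChangeLift E ρ).toLinearMap)
    (hA.baseChangeLift_injective ρ)
  rwa [Module.finrank_baseChange] at this

theorem IsCSA.baseChangeLift_bijective (hA : IsCSA F A) [Nontrivial S] [FiniteDimensional E S]
    (ρ : A →ₐ[F] S) (h : Module.finrank F A = Module.finrank E S) :
    Function.Bijective (baseChangeLift E ρ) := by
  have := hA.2.2
  refine ⟨hA.baseChangeLift_injective ρ, ?_⟩
  refine (LinearMap.injective_iff_surjective_of_finrank_eq_finrank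
    (f := (baseChangeLift E ρ).toLinearMap) ?_).1 (hA.baseChangeLift_injective ρ)
  rw [Module.finrank_baseChange, h]

theorem IsCSA.span_range_eq_top (hA : IsCSA F A) [Nontrivial S] [FiniteDimensional E S]
    (ρ : A →ₐ[F] S) (h : Module.finrank F A = Module.finrank E S) :
    Submodule.span E (Set.range ρ) = ⊤ := by
  refine eq_top_iff.2 fun s _ => ?_
  obtain ⟨t, rfl⟩ := (hA.baseChangeLift_bijective (E := E) ρ h).2 s
  induction t using TensorProduct.induction_on with
  | zero => simp
  | tmul x a =>
    rw [baseChangeLift_tmul]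
    exact Submodule.smul_mem _ _ (Submodule.subset_span ⟨a, rfl⟩)
  | add y z hy hz =>
    rw [map_add]
    exact add_mem (hy trivial) (hz trivial)

end

/-- The algebra `A` of dimension `N ^ 2` over `F` has a representation of dimension `N` over the
extension `E`. -/
def SplitsOver (F A E : Type) [Field F] [Ring A] [Algebra F A] [Field E] [Algebra F E] : Prop :=
  ∃ N : ℕ, N * N = Module.finrank F A ∧ Nonempty (A →ₐ[F] Matrix (Fin N) (Fin N) E)

theorem IsCSA.finrank_pos (hA : IsCSA F A) : 0 < Module.finrank F A :=
  have := hA.2.1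
  have := hA.2.2
  Module.finrank_pos

theorem IsCSA.pos_of_sq_eq (hA : IsCSA F A) {N : ℕ} (h : N * N = Module.finrank F A) : 0 < N :=
  Nat.pos_of_ne_zero fun h0 => by simpa [← h, h0] using hA.finrank_pos

theorem IsCSA.splitsOver_of_isAlgClosed (hA : IsCSA F A) (E : Type) [Field E] [Algebra F E]
    [IsAlgClosed E] : SplitsOver F A E := by
  have := hA.isSimpleRing_baseChange E
  have := hA.2.2
  obtain ⟨n, hn, ⟨e⟩⟩ := IsSimpleRing.exists_algEquiv_matrix_of_isAlgClosed E (E ⊗[F] A)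
  refine ⟨n, ?_, ⟨(e.toAlgHom.restrictScalars F).comp
    Algebra.TensorProduct.includeRight⟩⟩
  have := e.toLinearEquiv.finrank_eq
  rw [Module.finrank_baseChange] at this
  rw [this, Module.finrank_matrix]
  simp

theorem IsCSA.splitsOver_of_end (hA : IsCSA F A) {E V : Type} [Field E] [Algebra F E]
    [AddCommGroup V] [Module E V] [Module F V] [IsScalarTower F E V] [FiniteDimensional E V]
    [Nontrivial V] (f : A →ₐ[F] Module.End E V) {N : ℕ} (hN : N * N = Module.finrank F A)
    (h : Module.finrank E V ≤ N) : SplitsOver F A E := by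
  have h1 := hA.finrank_le E f
  rw [Module.finrank_linearMap, ← hN] at h1
  have h2 : Module.finrank E V = N := by
    refine h.antisymm (not_lt.1 fun hlt => ?_)
    have := Nat.mul_lt_mul'' hlt hlt
    lia
  refine ⟨N, hN, ⟨(AlgEquiv.toAlgHom
    ((algEquivMatrix (Module.finBasisOfFinrankEq E V h2)).restrictScalars F)).comp f⟩⟩

end SplitsOver

/-- The defining relations of the symbol algebra `[a, b)`. -/
structure SymbolRel (p : ℕ) {F R : Type} [Field F] [Ring R] [Algebra F R] (a b : F)
    (i j : R) : Prop where
  ne_zero : b ≠ 0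
  pow_sub : i ^ p - i = algebraMap F R a
  pow_eq : j ^ p = algebraMap F R b
  mul_eq : j * i = (i - 1) * j

namespace SymbolRel

open Polynomial

variable {p : ℕ} {F R : Type} [Field F] [Ring R] [Algebra F R] {a b : F} {i j : R}

theorem isUnit (h : SymbolRel p a b i j) (hp : p ≠ 0) : IsUnit j := by
  have : IsUnit (j ^ p) := by
    rw [h.pow_eq]
    exact (IsUnit.mk0 b h.ne_zero).map _
  exact (isUnit_pow_iff hp).1 this

theorem mul_aeval (h : SymbolRel p a b i j) (f : F[X]) :
    j * aeval i f = aeval i (f.comp (X - 1)) * j := by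
  induction f using Polynomial.induction_on' with
  | add f g hf hg => simp [mul_add, hf, hg, add_mul]
  | monomial n c =>
    have h1 : SemiconjBy j (i ^ n) ((i - 1) ^ n) := SemiconjBy.pow_right h.mul_eq n
    rw [aeval_monomial, monomial_comp, ← mul_assoc, ← Algebra.commutes, mul_assoc, h1.eq]
    simp [mul_assoc]

theorem pow_mul_eq (h : SymbolRel p a b i j) (t : ℕ) : j ^ t * i = (i - (t : R)) * j ^ t := by
  induction t with
  | zero => simp
  | succ t ih =>
    rw [pow_succ, mul_assoc, h.mul_eq, ← mul_assoc, mul_sub, ih, ← pow_succ]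
    rw [mul_one, ← sub_one_mul, mul_assoc, ← pow_succ]
    push_cast
    congr 1
    abel

theorem isIntegral (h : SymbolRel p a b i j) (hp : 1 < p) : IsIntegral F i := by
  refine ⟨X ^ p - (X + C a), monic_X_pow_sub ?_, ?_⟩
  · rw [degree_X_add_C]
    exact_mod_cast hp
  · simp only [eval₂_sub, eval₂_X_pow, eval₂_add, eval₂_X, eval₂_C, ← h.pow_sub]
    abel

theorem le_natDegree_minpoly [CharP F p] [Fact p.Prime] [Nontrivial R]
    (h : SymbolRel p a b i j) : p ≤ (minpoly F i).natDegree := by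
  have hp : p.Prime := Fact.out
  have hintegral := h.isIntegral hp.one_lt
  set μ := minpoly F i with hμ
  have hmonic : μ.Monic := minpoly.monic hintegral
  have hX : (X - 1 : F[X]) = X - C 1 := by simp
  have hshift : μ.comp (X - 1) = μ := by
    apply minpoly.unique
    · rw [hX]; exact hmonic.comp (monic_X_sub_C 1) (by rw [natDegree_X_sub_C]; exact one_ne_zero)
    · have := h.mul_aeval μ
      rw [minpoly.aeval, mul_zero] at this
      exact (h.isUnit hp.ne_zero).mul_left_eq_zero.1 this.symm
    · intro q hq hq0
      have := minpoly.min F i hq hq0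
      refine le_trans ?_ this
      rw [degree_eq_natDegree hmonic.ne_zero]
      refine degree_le_natDegree.trans ?_
      rw [natDegree_comp, hX, natDegree_X_sub_C, mul_one]
  by_contra! hlt
  have heval : ∀ k : ℕ, μ.eval (k : F) = μ.eval 0 := by
    intro k
    induction k with
    | zero => simp
    | succ k ih =>
      rw [← ih]
      conv_rhs => rw [← hshift]
      conv_lhs => rw [← hshift]
      have : ∀ x : F, μ.eval x = μ.eval (x - 1) := fun x => by
        conv_lhs => rw [← hshift]
        simp
      simp only [eval_comp, eval_sub, eval_X, eval_one]
      rw [this (k : F)] at *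
      push_cast
      rw [add_sub_cancel_right, this]
  have hconst : μ - C (μ.eval 0) = 0 := by
    apply eq_zero_of_natDegree_lt_card_of_eval_eq_zero _ (ι := Fin p)
      (f := fun k => ((k : ℕ) : F))
    · exact fun k l hkl => Fin.ext (CharP.natCast_injOn_Iio F p k.2 l.2 hkl)
    · intro k
      simp [heval]
    · rw [natDegree_sub_C, Fintype.card_fin]
      exact hlt
  have h0 : μ.natDegree = 0 := by
    rw [sub_eq_zero.1 hconst, natDegree_C]
  exact (minpoly.natDegree_pos hintegral).ne' h0

theorem linearIndependent_pow [CharP F p] [Fact p.Prime] [Nontrivial R]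
    (h : SymbolRel p a b i j) : LinearIndependent F fun s : Fin p => i ^ (s : ℕ) :=
  (_root_.linearIndependent_pow (K := F) i).comp (Fin.castLE h.le_natDegree_minpoly)
    (Fin.castLE_injective _)

theorem linearIndependent [CharP F p] [Fact p.Prime] [Nontrivial R]
    (h : SymbolRel p a b i j) :
    LinearIndependent F fun u : Fin p × Fin p => i ^ (u.2 : ℕ) * j ^ (u.1 : ℕ) := by
  classical
  have hp : p.Prime := Fact.out
  rw [Fintype.linearIndependent_iff]
  intro g hg
  let ad : Module.End F R := LinearMap.mulLeft F i - LinearMap.mulRight F i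
  let v : Fin p → R := fun t => (∑ s, g (t, s) • i ^ (s : ℕ)) * j ^ (t : ℕ)
  have hv : ∀ t : Fin p, v t ∈ ad.eigenspace ((t : ℕ) : F) := by
    intro t
    rw [Module.End.mem_eigenspace_iff]
    have hcomm : Commute i (∑ s, g (t, s) • i ^ (s : ℕ)) :=
      Commute.sum_right _ _ _ fun s _ => (Commute.pow_right (Commute.refl i) _).smul_right _
    simp only [ad, v, LinearMap.sub_apply, LinearMap.mulLeft_apply, LinearMap.mulRight_apply]
    rw [mul_assoc, h.pow_mul_eq, ← mul_assoc, hcomm.eq, mul_assoc, ← mul_sub, ← sub_mul,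
      sub_sub_cancel, ← mul_smul_comm, Algebra.smul_def, map_natCast]
  have hinj : Function.Injective fun t : Fin p => ((t : ℕ) : F) := fun k l hkl =>
    Fin.ext (CharP.natCast_injOn_Iio F p k.2 l.2 hkl)
  have hind := (Module.End.eigenspaces_iSupIndep ad).comp hinj
  rw [iSupIndep_iff_finsetSum_eq_zero_imp_eq_zero] at hind
  have hsum : ∑ t, v t = 0 := by
    rw [← hg, Fintype.sum_prod_type]
    simp [v, Finset.sum_mul]
  have hv0 : ∀ t, v t = 0 := fun t =>
    hind Finset.univ v (fun t _ => hv t) hsum t (Finset.mem_univ t)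
  rintro ⟨t, s⟩
  have h1 : ∑ s, g (t, s) • i ^ (s : ℕ) = 0 :=
    ((h.isUnit hp.ne_zero).pow _).mul_left_eq_zero.1 (hv0 t)
  exact Fintype.linearIndependent_iff.1 h.linearIndependent_pow (fun s => g (t, s)) h1 s

theorem sq_le_finrank [CharP F p] [Fact p.Prime] [Nontrivial R] [FiniteDimensional F R]
    (h : SymbolRel p a b i j) : p ^ 2 ≤ Module.finrank F R := by
  have := h.linearIndependent.fintype_card_le_finrank
  simpa [sq] using this

theorem aeval_smul_mem {V : Type} [AddCommGroup V] [Module F V] [Module R V]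
    [IsScalarTower F R V] (h : SymbolRel p a b i j) (hp : 1 < p) (w : V) (f : F[X]) :
    aeval i f • w ∈ Submodule.span F (Set.range fun s : Fin p => i ^ (s : ℕ) • w) := by
  have hmonic : (X ^ p - (X + C a)).Monic := monic_X_pow_sub (by
    rw [degree_X_add_C]
    exact_mod_cast hp)
  have h0 : aeval i (X ^ p - (X + C a)) = 0 := by
    simp [← h.pow_sub]
  rw [← modByMonic_add_div f (X ^ p - (X + C a)), map_add, map_mul, h0, zero_mul, add_zero]
  have hdeg : (f %ₘ (X ^ p - (X + C a))).natDegree < p := by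
    have hd : (X ^ p - (X + C a)).natDegree = p := by
      rw [natDegree_sub_eq_left_of_natDegree_lt, natDegree_X_pow]
      rwa [natDegree_X_add_C, natDegree_X_pow]
    have := natDegree_modByMonic_lt f hmonic (fun h1 => by
      rw [h1, natDegree_one] at hd; lia)
    rwa [hd] at this
  rw [aeval_eq_sum_range' hdeg, Finset.sum_smul]
  refine sum_mem fun s hs => ?_
  rw [smul_assoc]
  exact Submodule.smul_mem _ _ (Submodule.subset_span ⟨⟨s, Finset.mem_range.1 hs⟩, rfl⟩)

theorem span_eq_top (h : SymbolRel p a b i j) (hp : 1 < p)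
    (htop : Algebra.adjoin F {i, j} = ⊤) :
    Submodule.span F (Set.range fun u : Fin p × Fin p => i ^ (u.2 : ℕ) * j ^ (u.1 : ℕ)) = ⊤ := by
  set S := Submodule.span F (Set.range fun u : Fin p × Fin p => i ^ (u.2 : ℕ) * j ^ (u.1 : ℕ))
  have hgen : ∀ (f : F[X]) (t : ℕ), aeval i f * j ^ t ∈ S := by
    intro f t
    have ht : j ^ t = b ^ (t / p) • j ^ (t % p) := by
      conv_lhs => rw [← Nat.div_add_mod t p, pow_add, pow_mul, h.pow_eq, ← map_pow,
        ← Algebra.smul_def]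
    rw [ht, mul_smul_comm]
    refine Submodule.smul_mem _ _ ?_
    have := h.aeval_smul_mem hp (j ^ (t % p)) f
    refine Submodule.span_le.2 ?_ this
    rintro _ ⟨s, rfl⟩
    exact Submodule.subset_span ⟨(⟨t % p, Nat.mod_lt _ (by lia)⟩, s), rfl⟩
  have hi : ∀ x ∈ S, i * x ∈ S := by
    intro x hx
    induction hx using Submodule.span_induction with
    | mem x hx =>
      obtain ⟨u, rfl⟩ := hx
      have := hgen (X ^ (u.2.1 + 1)) u.1
      rwa [map_pow, aeval_X, pow_succ', mul_assoc] at this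
    | zero => simp
    | add x y _ _ hx hy => rw [mul_add]; exact add_mem hx hy
    | smul c x _ hx => rw [mul_smul_comm]; exact Submodule.smul_mem _ _ hx
  have hj : ∀ x ∈ S, j * x ∈ S := by
    intro x hx
    induction hx using Submodule.span_induction with
    | mem x hx =>
      obtain ⟨u, rfl⟩ := hx
      have := hgen ((X ^ (u.2.1)).comp (X - 1)) (u.1 + 1)
      rwa [pow_succ', ← mul_assoc, ← h.mul_aeval, map_pow, aeval_X, mul_assoc] at this
    | zero => simp
    | add x y _ _ hx hy => rw [mul_add]; exact add_mem hx hy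
    | smul c x _ hx => rw [mul_smul_comm]; exact Submodule.smul_mem _ _ hx
  refine eq_top_iff.2 fun x _ => ?_
  have hx : x ∈ Algebra.adjoin F {i, j} := htop ▸ trivial
  have key : ∀ y ∈ S, x * y ∈ S := by
    clear * - hi hj hx
    induction hx using Algebra.adjoin_induction with
    | mem x hx =>
      rcases hx with rfl | rfl
      · exact hi
      · exact hj
    | algebraMap r => intro y hy; rw [← Algebra.smul_def]; exact Submodule.smul_mem _ _ hy
    | add x y _ _ hx hy => intro z hz; rw [add_mul]; exact add_mem (hx z hz) (hy z hz)
    | mul x y _ _ hx hy => intro z hz; rw [mul_assoc]; exact hx _ (hy z hz)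
  simpa using key 1 (by simpa using hgen 1 0)

theorem isCyclicAlgWith [CharP F p] [Fact p.Prime] [Nontrivial R] (h : SymbolRel p a b i j)
    (htop : Algebra.adjoin F {i, j} = ⊤) : IsCyclicAlgWith p F R a b := by
  refine ⟨h.ne_zero, ?_, i, j, h.pow_sub, h.pow_eq, h.mul_eq, htop⟩
  have := Module.finrank_eq_card_basis
    (Module.Basis.mk h.linearIndependent (h.span_eq_top (Fact.out : p.Prime).one_lt htop).ge)
  simpa [sq] using this

end SymbolRel

section CyclicAlgebra

variable {p : ℕ} {F R S : Type} [Field F] [Ring R] [Algebra F R] [Ring S] [Algebra F S]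

theorem SymbolRel.map {a b : F} {i j : R} (h : SymbolRel p a b i j) (f : R →ₐ[F] S) :
    SymbolRel p a b (f i) (f j) where
  ne_zero := h.ne_zero
  pow_sub := by rw [← map_pow, ← map_sub, h.pow_sub, AlgHom.commutes]
  pow_eq := by rw [← map_pow, h.pow_eq, AlgHom.commutes]
  mul_eq := by rw [← map_mul, h.mul_eq, map_mul, map_sub, map_one]

theorem SymbolRel.extendScalars {a b : F} {i j : R} (h : SymbolRel p a b i j) (E : Type)
    [Field E] [Algebra F E] [Algebra E R] [IsScalarTower F E R] :
    SymbolRel p (algebraMap F E a) (algebraMap F E b) i j where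
  ne_zero := by simpa using h.ne_zero
  pow_sub := by rw [h.pow_sub, ← IsScalarTower.algebraMap_apply]
  pow_eq := by rw [h.pow_eq, ← IsScalarTower.algebraMap_apply]
  mul_eq := h.mul_eq

theorem IsCyclicPAlg.isSimpleRing [CharP F p] [Fact p.Prime] (h : IsCyclicPAlg p F R) :
    IsSimpleRing R := by
  obtain ⟨a, b, hb, hrank, i, j, hi, hj, hij, -⟩ := h
  have hrel : SymbolRel p a b i j := ⟨hb, hi, hj, hij⟩
  have hp : p.Prime := Fact.out
  have hpos : 0 < Module.finrank F R := hrank ▸ pow_pos hp.pos 2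
  have := Module.finite_of_finrank_pos hpos
  have := Module.nontrivial_of_finrank_pos hpos
  rw [isSimpleRing_iff_isTwoSided_imp]
  refine ⟨inferInstance, fun I hI => or_iff_not_imp_right.2 fun hne => ?_⟩
  have : Nontrivial (R ⧸ I) := Ideal.Quotient.nontrivial_iff.2 hne
  have hle := (hrel.map (Ideal.Quotient.mkₐ F I)).sq_le_finrank
  have hadd := Submodule.finrank_quotient_add_finrank (I.restrictScalars F)
  have h0 : Module.finrank F (I.restrictScalars F) = 0 := by
    have : Module.finrank F (R ⧸ I.restrictScalars F) = Module.finrank F (R ⧸ I) := rfl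
    lia
  have := Submodule.finrank_eq_zero.1 h0
  rwa [Submodule.restrictScalars_eq_bot_iff] at this

theorem IsCyclicPAlg.isCSA [CharP F p] [Fact p.Prime] (h : IsCyclicPAlg p F R) :
    IsCSA F R := by
  have hs := h.isSimpleRing
  obtain ⟨a, b, hb, hrank, i, j, hi, hj, hij, -⟩ := h
  have hrel : SymbolRel p a b i j := ⟨hb, hi, hj, hij⟩
  have hp : p.Prime := Fact.out
  have hpos : 0 < Module.finrank F R := hrank ▸ pow_pos hp.pos 2
  have := Module.finite_of_finrank_pos hpos
  refine ⟨⟨?_⟩, hs, this⟩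
  have hf : IsField (Subalgebra.center F R) := IsSimpleRing.isField_center R
  let : Field (Subalgebra.center F R) :=
    { (inferInstance : CommRing (Subalgebra.center F R)), hf.toField with }
  let : Algebra (Subalgebra.center F R) R :=
    { algebraMap := (Subalgebra.center F R).val.toRingHom
      commutes' := fun r x => (Subalgebra.mem_center_iff.1 r.2 x).symm
      smul_def' := fun r x => rfl }
  have : CharP (Subalgebra.center F R) p :=
    charP_of_injective_algebraMap (algebraMap F (Subalgebra.center F R)).injective p
  have : FiniteDimensional (Subalgebra.center F R) R := .of_restrictScalars_finite F _ _
  have hle := (hrel.extendScalars (Subalgebra.center F R)).sq_le_finrank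
  have hmul := Module.finrank_mul_finrank F (Subalgebra.center F R) R
  have h1 : Module.finrank F (Subalgebra.center F R) = 1 := by
    have h0 : Module.finrank F (Subalgebra.center F R) ≠ 0 := fun h0 => by
      rw [h0, zero_mul] at hmul; lia
    rw [hrank] at hmul
    by_contra hne
    have h2 : 2 ≤ Module.finrank F (Subalgebra.center F R) := by lia
    have := Nat.mul_le_mul h2 hle
    have := pow_pos hp.pos 2
    lia
  exact (Subalgebra.eq_bot_of_finrank_one h1).le

theorem IsCyclicPAlg.mulOpposite [CharP F p] [Fact p.Prime] (h : IsCyclicPAlg p F R) :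
    IsCyclicPAlg p F Rᵐᵒᵖ := by
  have hp : p.Prime := Fact.out
  obtain ⟨a, b, hb, hrank, i, j, hi, hj, hij, htop⟩ := h
  refine ⟨-a, b, hb, ?_, -MulOpposite.op i, MulOpposite.op j, ?_, ?_, ?_, ?_⟩
  · rw [← hrank]
    exact (MulOpposite.opLinearEquiv F).finrank_eq.symm
  · have : (-1 : F) ^ p = -1 := by
      have := sub_pow_char (0 : F) 1 (p := p)
      simpa [hp.ne_zero] using this
    have h1 : (-1 : Rᵐᵒᵖ) ^ p = -1 := by
      have := congrArg (algebraMap F Rᵐᵒᵖ) this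
      simpa using this
    rw [neg_pow, h1, ← MulOpposite.op_pow, neg_one_mul, sub_neg_eq_add, ← sub_eq_neg_add,
      ← MulOpposite.op_sub, map_neg]
    rw [MulOpposite.algebraMap_apply, ← hi, ← MulOpposite.op_neg, neg_sub]
  · rw [← MulOpposite.op_pow, hj, MulOpposite.algebraMap_apply]
  · rw [← MulOpposite.op_neg, ← MulOpposite.op_one, ← MulOpposite.op_sub, ← MulOpposite.op_mul,
      ← MulOpposite.op_mul, mul_sub, mul_neg, hij]
    congr 1
    noncomm_ring
  · refine eq_top_iff.2 fun x _ => ?_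
    have hx : x.unop ∈ Algebra.adjoin F {i, j} := htop ▸ trivial
    rw [← MulOpposite.op_unop x]
    generalize x.unop = y at hx
    clear htop
    induction hx using Algebra.adjoin_induction with
    | mem y hy =>
      rcases hy with rfl | rfl
      · rw [← neg_neg (MulOpposite.op y)]
        exact neg_mem (Algebra.subset_adjoin (by simp))
      · exact Algebra.subset_adjoin (by simp)
    | algebraMap r =>
      rw [← MulOpposite.algebraMap_apply]
      exact algebraMap_mem _ r
    | add x y _ _ hx hy => exact add_mem hx hy
    | mul x y _ _ hx hy => exact mul_mem hy hx

end CyclicAlgebra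

section BrauerEquivalence

variable {F : Type} [Field F]

section PiTensor

variable {k : ℕ} (X : Fin (k + 1) → Type) [∀ i, Ring (X i)] [∀ i, Algebra F (X i)]

/-- Splitting off the first factor of a tensor product. -/
noncomputable def piTensorConsHom :
    (⨂[F] i, X i) →ₐ[F] X 0 ⊗[F] (⨂[F] i : Fin k, X i.succ) :=
  PiTensorProduct.liftAlgHom
    (LinearMap.uncurryLeft
      { toFun := fun x => (TensorProduct.mk F (X 0) (⨂[F] i : Fin k, X i.succ) x).compMultilinearMap
          (PiTensorProduct.tprod F)
        map_add' := fun x y => by ext; simp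
        map_smul' := fun c x => by ext; simp [TensorProduct.smul_tmul'] })
    rfl fun x y => by
      simp only [LinearMap.uncurryLeft_apply, LinearMap.coe_mk, AddHom.coe_mk,
        LinearMap.compMultilinearMap_apply, TensorProduct.mk_apply,
        Algebra.TensorProduct.tmul_mul_tmul, PiTensorProduct.tprod_mul_tprod]
      rfl

theorem piTensorConsHom_tprod (m : ∀ i, X i) :
    piTensorConsHom (F := F) X (PiTensorProduct.tprod F m) =
      m 0 ⊗ₜ PiTensorProduct.tprod F (Fin.tail m) :=
  (PiTensorProduct.liftAlgHom_apply _ _ _ _).trans (PiTensorProduct.lift.tprod _)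

theorem piTensorConsHom_bijective : Function.Bijective (piTensorConsHom (F := F) X) := by
  constructor
  · let Φ : X 0 ⊗[F] (⨂[F] i : Fin k, X i.succ) →ₗ[F] ⨂[F] i, X i :=
      TensorProduct.lift
        (PiTensorProduct.lift.toLinearMap ∘ₗ (PiTensorProduct.tprod F (s := X)).curryLeft)
    have h : Φ ∘ₗ (piTensorConsHom (F := F) X).toLinearMap = LinearMap.id := by
      ext m
      simp only [LinearMap.compMultilinearMap_apply, LinearMap.comp_apply,
        AlgHom.toLinearMap_apply, piTensorConsHom_tprod, Φ, TensorProduct.lift.tmul]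
      simp
    exact Function.LeftInverse.injective (g := Φ) fun x => LinearMap.congr_fun h x
  · rw [← AlgHom.coe_toLinearMap, ← LinearMap.range_eq_top, eq_top_iff]
    rintro x -
    induction x using TensorProduct.induction_on with
    | zero => exact zero_mem _
    | add x y hx hy => exact add_mem hx hy
    | tmul a t =>
      induction t using PiTensorProduct.induction_on with
      | smul_tprod r m =>
        rw [TensorProduct.tmul_smul]
        refine Submodule.smul_mem _ _ ⟨PiTensorProduct.tprod F (Fin.cons a m), ?_⟩
        rw [AlgHom.toLinearMap_apply, piTensorConsHom_tprod]
        simp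
      | add x y hx hy =>
        rw [TensorProduct.tmul_add]
        exact add_mem hx hy

end PiTensor

theorem exists_piTensorProduct_cons {k : ℕ} (P : ∀ (C : Type) [Ring C] [Algebra F C], Prop)
    (C : Type) [iC : Ring C] [aC : Algebra F C] (D : Fin k → Type) [iR : ∀ i, Ring (D i)]
    [iA : ∀ i, Algebra F (D i)] (hC : P C) (hD : ∀ i, P (D i)) :
    ∃ (D' : Fin (k + 1) → Type) (_ : ∀ i, Ring (D' i)) (_ : ∀ i, Algebra F (D' i)),
      (∀ i, P (D' i)) ∧ Nonempty ((⨂[F] i, D' i) ≃ₐ[F] C ⊗[F] (⨂[F] i, D i)) := by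
  let D' : Fin (k + 1) → Type := Fin.cons C D
  let iR' : ∀ i, Ring (D' i) := Fin.cases (motive := fun i => Ring (D' i)) iC iR
  let iA' : ∀ i, Algebra F (D' i) := Fin.cases (motive := fun i => Algebra F (D' i)) aC iA
  refine ⟨D', iR', iA', fun i => ?_, ⟨AlgEquiv.ofBijective _ (piTensorConsHom_bijective D')⟩⟩
  cases i using Fin.cases with
  | zero => exact hC
  | succ i => exact hD i

variable {A B : Type} [Ring A] [Algebra F A] [Ring B] [Algebra F B]

theorem IsBrauerEquiv.of_fintype {ι κ : Type} [Fintype ι] [DecidableEq ι] [Nonempty ι]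
    [Fintype κ] [DecidableEq κ] [Nonempty κ] (e : Matrix ι ι A ≃ₐ[F] Matrix κ κ B) :
    IsBrauerEquiv F A B :=
  ⟨Fintype.card ι, Fintype.card κ, Fintype.card_pos, Fintype.card_pos,
    ⟨(Matrix.reindexAlgEquiv F A (Fintype.equivFin ι)).symm.trans
      (e.trans (Matrix.reindexAlgEquiv F B (Fintype.equivFin κ)))⟩⟩

/-- Matrices over a tensor product. -/
noncomputable def matrixTensorAlgEquiv (ι : Type) [Fintype ι] [DecidableEq ι] :
    Matrix ι ι A ⊗[F] B ≃ₐ[F] Matrix ι ι (A ⊗[F] B) :=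
  (Algebra.TensorProduct.congr (matrixEquivTensor ι F A) .refl).trans <|
    (Algebra.TensorProduct.assoc F F F A (Matrix ι ι F) B).trans <|
    (Algebra.TensorProduct.congr .refl (Algebra.TensorProduct.comm F (Matrix ι ι F) B)).trans <|
    (Algebra.TensorProduct.assoc F F F A B (Matrix ι ι F)).symm.trans
      (matrixEquivTensor ι F (A ⊗[F] B)).symm

theorem IsCSA.nonempty_tensor_op_algEquiv (hA : IsCSA F A) :
    Nonempty (A ⊗[F] Aᵐᵒᵖ ≃ₐ[F]
      Matrix (Fin (Module.finrank F A)) (Fin (Module.finrank F A)) F) := by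
  have := hA.2.2
  have := hA.2.1
  have hb : Function.Bijective (AlgHom.mulLeftRight F A) :=
    ⟨have := hA.isSimpleRing_tensorProduct (B := Aᵐᵒᵖ)
     (AlgHom.mulLeftRight F A).toRingHom.injective, hA.mulLeftRight_surjective⟩
  exact ⟨(AlgEquiv.ofBijective _ hb).trans (algEquivMatrix (Module.finBasis F A))⟩

theorem SymbolLengthLE.of_tensor {p k : ℕ} [CharP F p] [Fact p.Prime]
    (hB : IsCyclicPAlg p F B) (h : SymbolLengthLE p F (A ⊗[F] B) k) :
    SymbolLengthLE p F A (k + 1) := by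
  obtain ⟨k', hk, D, iR, iA, hD, n, m, hn, hm, ⟨e⟩⟩ := h
  obtain ⟨D', iR', iA', hD', ⟨f⟩⟩ := exists_piTensorProduct_cons (F := F)
    (fun C [Ring C] [Algebra F C] => IsCyclicPAlg p F C) Bᵐᵒᵖ D hB.mulOpposite hD
  have hB' := hB.isCSA
  have : Nonempty (Fin (Module.finrank F B)) := ⟨⟨0, hB'.finrank_pos⟩⟩
  have : Nonempty (Fin n) := ⟨⟨0, hn⟩⟩
  have : Nonempty (Fin m) := ⟨⟨0, hm⟩⟩
  obtain ⟨e'⟩ := hB'.nonempty_tensor_op_algEquiv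
  refine ⟨k' + 1, by lia, D', iR', iA', hD', ?_⟩
  · let f' : (⨂[F] i, D' i) ≃ₐ[F] (⨂[F] i, D i) ⊗[F] Bᵐᵒᵖ :=
      f.trans (Algebra.TensorProduct.comm F _ _)
    refine IsBrauerEquiv.of_fintype (ι := Fin n × Fin (Module.finrank F B)) (κ := Fin m) ?_
    refine (Matrix.compAlgEquiv (Fin n) (Fin (Module.finrank F B)) A F).symm.trans ?_
    refine AlgEquiv.trans ?_ f'.symm.mapMatrix
    refine AlgEquiv.trans ?_ (matrixTensorAlgEquiv (Fin m))
    refine AlgEquiv.trans ?_ (Algebra.TensorProduct.congr e .refl)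
    refine AlgEquiv.trans ?_ (matrixTensorAlgEquiv (Fin n)).symm
    refine AlgEquiv.mapMatrix ?_
    refine AlgEquiv.trans ?_ (Algebra.TensorProduct.assoc F F F A B Bᵐᵒᵖ).symm
    exact (matrixEquivTensor _ F A).trans (Algebra.TensorProduct.congr .refl e'.symm)

theorem SymbolLengthLE.of_isSplitAlg {p : ℕ} (h : IsSplitAlg F A) (k : ℕ) :
    SymbolLengthLE p F A k := by
  obtain ⟨n, hn, ⟨e⟩⟩ := h
  have : Nonempty (Fin n) := ⟨⟨0, hn⟩⟩
  refine ⟨0, zero_le, fun _ => F, inferInstance, inferInstance, fun i => i.elim0, ?_⟩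
  refine IsBrauerEquiv.of_fintype (ι := Unit) (κ := Fin n) ?_
  refine (Matrix.uniqueAlgEquiv (m := Unit) (R := F) (A := A)).trans (e.trans ?_)
  exact (PiTensorProduct.constantBaseRingEquiv (Fin 0) F).symm.mapMatrix

theorem SymbolLengthLE.mono {p k l : ℕ} (h : SymbolLengthLE p F A k) (hkl : k ≤ l) :
    SymbolLengthLE p F A l := by
  obtain ⟨k', hk, h⟩ := h
  exact ⟨k', hk.trans hkl, h⟩

end BrauerEquivalence

section InnerDerivation

theorem Matrix.map_derivation_mul {F E n : Type} [Field F] [Field E] [Algebra F E] [Fintype n]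
    (d : Derivation F E E) (X Y : Matrix n n E) :
    (X * Y).map d = X.map d * Y + X * Y.map d := by
  ext u v
  simp only [Matrix.map_apply, Matrix.mul_apply, Matrix.add_apply, map_sum, Derivation.leibniz,
    smul_eq_mul, ← Finset.sum_add_distrib]
  exact Finset.sum_congr rfl fun k _ => by ring

theorem Matrix.mul_single_one {E n : Type} [Field E] [Fintype n] [DecidableEq n]
    (X : Matrix n n E) (k o : n) :
    X * Matrix.single k o 1 = ∑ u, X u k • Matrix.single u o 1 := by
  ext a b
  rw [Matrix.sum_apply]
  by_cases hb : o = b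
  · subst hb
    simp [Matrix.single_apply]
  · simp [hb, Matrix.mul_single_apply_of_ne, Ne.symm hb]

theorem Matrix.exists_eq_commutator {E : Type} [Field E] {N : ℕ}
    (δ : Matrix (Fin N) (Fin N) E →ₗ[E] Matrix (Fin N) (Fin N) E)
    (h : ∀ X Y, δ (X * Y) = δ X * Y + X * δ Y) :
    ∃ T : Matrix (Fin N) (Fin N) E, ∀ X, δ X = T * X - X * T := by
  rcases Nat.eq_zero_or_pos N with rfl | hN
  · exact ⟨0, fun X => Subsingleton.elim _ _⟩
  let o : Fin N := ⟨0, hN⟩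
  have hdec : ∀ X : Matrix (Fin N) (Fin N) E, ∀ k, X * Matrix.single k o 1 =
      ∑ u, X u k • Matrix.single u o 1 := fun X k => X.mul_single_one k o
  have hdec' : ∀ X : Matrix (Fin N) (Fin N) E, ∀ u, Matrix.single o u 1 * X =
      ∑ k, X u k • Matrix.single o k 1 := by
    intro X k
    ext a b
    rw [Matrix.sum_apply]
    by_cases hb : o = a
    · subst hb
      simp [Matrix.single_apply]
    · simp [hb, Matrix.single_mul_apply_of_ne, Ne.symm hb]
  refine ⟨∑ k, δ (Matrix.single k o 1) * Matrix.single o k 1, fun X => ?_⟩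
  have h1 : ∑ k : Fin N, (Matrix.single k o (1 : E)) * Matrix.single o k 1 = 1 := by
    simp [Matrix.single_mul_single_same, Matrix.sum_single_one]
  have h2 : ∀ k, X * δ (Matrix.single k o 1) =
      δ (X * Matrix.single k o 1) - δ X * Matrix.single k o 1 := fun k => by
    rw [h, add_sub_cancel_left]
  rw [Finset.mul_sum, Finset.sum_mul]
  simp_rw [← mul_assoc, h2, sub_mul, Finset.sum_sub_distrib, mul_assoc, ← Finset.mul_sum, h1,
    hdec, hdec', map_sum, map_smul, Finset.sum_mul, Finset.mul_sum]
  rw [Finset.sum_comm]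
  simp only [mul_smul_comm, smul_mul_assoc, mul_one, sub_sub_cancel]

theorem IsCSA.exists_map_derivation_eq {F A E : Type} [Field F] [Ring A] [Algebra F A] [Field E]
    [Algebra F E] (hA : IsCSA F A) {N : ℕ} (hN : N * N = Module.finrank F A)
    (ρ : A →ₐ[F] Matrix (Fin N) (Fin N) E) (d : Derivation F E E) :
    ∃ T : Matrix (Fin N) (Fin N) E, ∀ a, (ρ a).map d = T * ρ a - ρ a * T := by
  have : Nonempty (Fin N) := ⟨⟨0, hA.pos_of_sq_eq hN⟩⟩
  have hrank : Module.finrank F A = Module.finrank E (Matrix (Fin N) (Fin N) E) := by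
    rw [Module.finrank_matrix]
    simp [hN]
  let φ := AlgEquiv.ofBijective _ (hA.baseChangeLift_bijective (E := E) ρ hrank)
  let dM : Matrix (Fin N) (Fin N) E →ₗ[F] Matrix (Fin N) (Fin N) E :=
    d.toLinearMap.mapMatrix
  let δ : Matrix (Fin N) (Fin N) E →ₗ[E] Matrix (Fin N) (Fin N) E :=
    (LinearMap.liftBaseChange E (dM ∘ₗ ρ.toLinearMap)) ∘ₗ φ.symm.toLinearMap
  have hδ : ∀ a, δ (ρ a) = (ρ a).map d := by
    intro a
    have : φ.symm (ρ a) = 1 ⊗ₜ a := by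
      rw [AlgEquiv.symm_apply_eq]
      simp [φ]
    simp only [δ, LinearMap.comp_apply, AlgEquiv.toLinearMap_apply, this]
    simp [dM]
  have hspan := hA.span_range_eq_top ρ hrank
  have hmul : ∀ X Y, δ (X * Y) = δ X * Y + X * δ Y := by
    intro X Y
    have hX : X ∈ Submodule.span E (Set.range ρ) := hspan ▸ trivial
    have hY : Y ∈ Submodule.span E (Set.range ρ) := hspan ▸ trivial
    clear hspan
    induction hX, hY using Submodule.span_induction₂ with
    | mem_mem x y hx hy =>
      obtain ⟨a, rfl⟩ := hx
      obtain ⟨b, rfl⟩ := hy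
      rw [← map_mul, hδ, hδ, hδ, map_mul, Matrix.map_derivation_mul]
    | zero_left => simp
    | zero_right => simp
    | add_left x y z _ _ _ hx hy => simp only [add_mul, map_add, hx, hy]; abel
    | add_right x y z _ _ _ hx hy => simp only [mul_add, map_add, hx, hy]; abel
    | smul_left r x y _ _ hx => simp [hx]
    | smul_right r x y _ _ hx => simp [hx]
  obtain ⟨T, hT⟩ := Matrix.exists_eq_commutator δ hmul
  exact ⟨T, fun a => by rw [← hδ, hT]⟩

end InnerDerivation

section EulerDerivation

open Polynomial

theorem exists_derivation_of_pow_eq {p : ℕ} [Fact p.Prime] {K E : Type} [Field K] [Field E]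
    [Algebra K E] [CharP K p] {γ : E} {c : K} (hc : γ ^ p = algebraMap K E c)
    (hγ : ∀ x : K, algebraMap K E x ≠ γ) (htop : Algebra.adjoin K {γ} = ⊤) :
    Module.finrank K E = p ∧ ∃ d : Derivation K E E, d γ = γ ∧
      ∀ x, d x = 0 → ∃ y, algebraMap K E y = x := by
  have hp : p.Prime := Fact.out
  have : CharP E p := charP_of_injective_algebraMap (algebraMap K E).injective p
  have hirr : Irreducible (X ^ p - C c : K[X]) := by
    refine X_pow_sub_C_irreducible_of_prime hp fun x hx => hγ x ?_
    refine frobenius_inj E p ?_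
    rw [frobenius_def, frobenius_def, hc, ← hx, map_pow]
  have hmonic : (X ^ p - C c : K[X]).Monic := monic_X_pow_sub_C c hp.ne_zero
  have hmin : minpoly K γ = X ^ p - C c := by
    refine (minpoly.eq_of_irreducible_of_monic hirr ?_ hmonic).symm
    simp [hc]
  have hintegral : IsIntegral K γ := ⟨_, hmonic, by simp [hc]⟩
  let pb : PowerBasis K E := PowerBasis.ofAdjoinEqTop hintegral htop
  have hgen : pb.gen = γ := PowerBasis.ofAdjoinEqTop_gen hintegral htop
  have hdim : pb.dim = p := by
    rw [← PowerBasis.natDegree_minpoly, hgen, hmin, natDegree_X_pow_sub_C]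
  have hbas : ∀ k, pb.basis k = γ ^ (k : ℕ) := fun k => by rw [pb.basis_eq_pow, hgen]
  let d : E →ₗ[K] E := pb.basis.constr K fun k => ((k : ℕ) : E) * γ ^ (k : ℕ)
  have hd0 : ∀ k, k < p → d (γ ^ k) = (k : E) * γ ^ k := by
    intro k hk
    have h1 := hbas ⟨k, hdim ▸ hk⟩
    simp only at h1
    have h2 := pb.basis.constr_basis K (fun k => ((k : ℕ) : E) * γ ^ (k : ℕ)) ⟨k, hdim ▸ hk⟩
    rwa [h1] at h2
  have hd : ∀ k : ℕ, d (γ ^ k) = (k : E) * γ ^ k := by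
    intro k
    have hk : γ ^ k = c ^ (k / p) • γ ^ (k % p) := by
      conv_lhs => rw [← Nat.div_add_mod k p, pow_add, pow_mul, hc]
      rw [Algebra.smul_def, map_pow]
    have hkp : ((k % p : ℕ) : E) = k := by
      conv_rhs => rw [← Nat.div_add_mod k p]
      simp
    rw [hk, map_smul, hd0 _ (Nat.mod_lt _ hp.pos), hkp, mul_smul_comm]
  have hda : ∀ f : K[X], d (aeval γ f) = aeval γ (X * derivative f) := by
    intro f
    induction f using Polynomial.induction_on' with
    | add f g hf hg => simp only [map_add, hf, hg, mul_add]
    | monomial k a =>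
      rw [aeval_monomial, ← Algebra.smul_def, map_smul, hd, derivative_monomial]
      rcases k with _ | k
      · simp
      · simp [aeval_monomial, Algebra.smul_def, pow_succ]
        ring
  have hsurj : ∀ x : E, ∃ f : K[X], aeval γ f = x := by
    intro x
    have hx : x ∈ Algebra.adjoin K {γ} := htop ▸ trivial
    rwa [Algebra.adjoin_singleton_eq_range_aeval] at hx
  refine ⟨by rw [pb.finrank, hdim], Derivation.mk' d fun x y => ?_, ?_, fun x hx => ?_⟩
  · obtain ⟨f, rfl⟩ := hsurj x
    obtain ⟨g, rfl⟩ := hsurj y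
    rw [← map_mul, hda, hda, hda, derivative_mul]
    simp only [map_mul, map_add, smul_eq_mul]
    ring
  · simpa using hd 1
  · replace hx : d x = 0 := hx
    have h0 : 0 < pb.dim := hdim ▸ hp.pos
    refine ⟨pb.basis.repr x ⟨0, h0⟩, ?_⟩
    have hx1 : ∑ k : Fin pb.dim, (((k : ℕ) : K) * pb.basis.repr x k) • pb.basis k = 0 := by
      rw [← hx]
      conv_rhs => rw [← pb.basis.sum_repr x, map_sum]
      refine Finset.sum_congr rfl fun k _ => ?_
      rw [map_smul, hbas, hd, mul_comm, mul_smul]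
      congr 1
      rw [Algebra.smul_def, map_natCast]
    have hx2 := Fintype.linearIndependent_iff.1 pb.basis.linearIndependent _ hx1
    conv_rhs => rw [← pb.basis.sum_repr x]
    rw [Finset.sum_eq_single ⟨0, h0⟩]
    · rw [hbas]
      simp [Algebra.smul_def]
    · intro k _ hk
      have hk0 : ((k : ℕ) : K) ≠ 0 := by
        rw [Ne, CharP.cast_eq_zero_iff K p]
        refine Nat.not_dvd_of_pos_of_lt (Nat.pos_of_ne_zero fun h => hk (Fin.ext h)) ?_
        exact hdim ▸ k.2
      rw [(mul_eq_zero.1 (hx2 k)).resolve_left hk0, zero_smul]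
    · simp

end EulerDerivation

section Albert

/-- The action of matrices over `E` on column vectors, as `K`-linear endomorphisms. -/
noncomputable def matrixEnd (K : Type) {E : Type} [Field K] [Field E] [Algebra K E] (N : ℕ) :
    Matrix (Fin N) (Fin N) E →ₐ[K] Module.End K (Fin N → E) where
  toFun X := (Matrix.mulVecLin X).restrictScalars K
  map_one' := by ext; simp
  map_zero' := by ext; simp
  map_mul' X Y := by ext; simp
  map_add' X Y := by ext; simp
  commutes' r := by
    refine LinearMap.ext fun v => ?_
    simp [Algebra.algebraMap_eq_smul_one]

@[simp]
theorem matrixEnd_apply {K E : Type} [Field K] [Field E] [Algebra K E] {N : ℕ}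
    (X : Matrix (Fin N) (Fin N) E) (v : Fin N → E) : matrixEnd K N X v = X.mulVec v := rfl

theorem matrixEnd_exists_eq_smul_one {K E : Type} [Field K] [Field E] [Algebra K E] {N : ℕ}
    (hN : 0 < N) (h : Module.End K (Fin N → E)) (hh : ∀ X, Commute h (matrixEnd K N X)) :
    ∃ e : E, h = matrixEnd K N (e • 1) := by
  let o : Fin N := ⟨0, hN⟩
  have key : ∀ (X : Matrix (Fin N) (Fin N) E) v, h (X.mulVec v) = X.mulVec (h v) := fun X v =>
    LinearMap.congr_fun (hh X) v
  refine ⟨h (Pi.single o 1) o, LinearMap.ext fun v => ?_⟩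
  have h1 : h (Pi.single o 1) = h (Pi.single o 1) o • Pi.single o 1 := by
    have h2 := key (Matrix.single o o 1) (Pi.single o 1)
    rw [Matrix.single_mulVec, Matrix.single_mulVec] at h2
    simp only [Pi.single_eq_same, one_mul] at h2
    refine (congrArg h ?_).trans (h2.trans ?_)
    · rfl
    ext k
    simp [Pi.single_apply, Function.update_apply]
  have hv : v = (∑ k, v k • Matrix.single k o 1).mulVec (Pi.single o 1) := by
    ext k
    simp [Matrix.single_apply, Matrix.sum_apply]
  conv_lhs => rw [hv, key, h1, Matrix.mulVec_smul, ← hv]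
  simp [Matrix.smul_mulVec]

theorem matrixEnd_derivation {K E : Type} [Field K] [Field E] [Algebra K E] {N : ℕ}
    (d : Derivation K E E) (X : Matrix (Fin N) (Fin N) E) :
    (d : E →ₗ[K] E).compLeft (Fin N) * matrixEnd K N X =
      matrixEnd K N (X.map d) + matrixEnd K N X * (d : E →ₗ[K] E).compLeft (Fin N) := by
  refine LinearMap.ext fun v => funext fun k => ?_
  simp [Matrix.mulVec, dotProduct, ← Finset.sum_add_distrib]
  exact Finset.sum_congr rfl fun k _ => by ring


theorem Matrix.smul_one_map_derivation {K E : Type} [Field K] [Field E] [Algebra K E] {N : ℕ}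
    (d : Derivation K E E) (e : E) :
    (e • (1 : Matrix (Fin N) (Fin N) E)).map d = d e • (1 : Matrix (Fin N) (Fin N) E) := by
  ext k l
  by_cases h : k = l
  · subst h; simp
  · simp [h]

/-- Over a purely inseparable extension `E / E₀` of degree `p` generated by a `p`-th root `γ` of
an element of `F`, the algebra `A` split by `E` becomes split by `E₀` after tensoring with a
cyclic algebra of degree `p`. -/
theorem IsCSA.exists_isCyclicPAlg_splitsOver {p : ℕ} [Fact p.Prime] {F E₀ E A : Type} [Field F]
    [Field E₀] [Field E] [Algebra F E₀] [Algebra E₀ E] [Algebra F E] [IsScalarTower F E₀ E]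
    [CharP F p] [Ring A] [Algebra F A] (hA : IsCSA F A) (hs : SplitsOver F A E) {γ : E} {c : F}
    (hc : γ ^ p = algebraMap F E c) (hγ : ∀ x : E₀, algebraMap E₀ E x ≠ γ)
    (htop : Algebra.adjoin E₀ {γ} = ⊤) (hE₀ : ∀ x : E₀, ∃ y : F, algebraMap F E₀ y = x ^ p) :
    ∃ (D : Type) (_ : Ring D) (_ : Algebra F D), IsCyclicPAlg p F D ∧
      SplitsOver F (A ⊗[F] D) E₀ := by
  have hp : p.Prime := Fact.out
  have : CharP E₀ p := charP_of_injective_algebraMap (algebraMap F E₀).injective p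
  obtain ⟨N, hN, ⟨ρ⟩⟩ := hs
  have hNpos := hA.pos_of_sq_eq hN
  have : Nonempty (Fin N) := ⟨⟨0, hNpos⟩⟩
  have hc₀ : γ ^ p = algebraMap E₀ E (algebraMap F E₀ c) := by
    rw [hc, ← IsScalarTower.algebraMap_apply]
  obtain ⟨hdeg, d, hdγ, hker⟩ := exists_derivation_of_pow_eq hc₀ hγ htop
  have : FiniteDimensional E₀ E := Module.finite_of_finrank_pos (hdeg ▸ hp.pos)
  obtain ⟨T, hT⟩ := hA.exists_map_derivation_eq hN ρ (d.restrictScalars F)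
  have : CharP (Module.End E₀ (Fin N → E)) p :=
    charP_of_injective_algebraMap (algebraMap E₀ _).injective p
  let μ := matrixEnd E₀ (E := E) N
  have hscal : ∀ (e : E) X, μ (e • X) = μ (e • 1) * μ X := fun e X => by
    rw [← map_mul, smul_one_mul]
  have hE : ∀ x : E₀, μ (algebraMap E₀ E x • 1) = algebraMap E₀ _ x := fun x => by
    rw [algebraMap_smul, ← Algebra.algebraMap_eq_smul_one, AlgHom.commutes]
  let i : Module.End E₀ (Fin N → E) := (d : E →ₗ[E₀] E).compLeft (Fin N) - μ T
  have hi : ∀ X, i * μ X = μ X * i + μ (X.map d - T * X + X * T) := fun X => by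
    simp only [i, sub_mul, mul_sub, map_add, map_sub, map_mul, matrixEnd_derivation, μ]
    abel
  have hiρ : ∀ a, Commute i (μ (ρ a)) := fun a => by
    have : (ρ a).map d = T * ρ a - ρ a * T := hT a
    rw [Commute, SemiconjBy, hi, this]
    simp
  have hie : ∀ e : E, i * μ (e • 1) = μ (e • 1) * i + μ (d e • 1) := fun e => by
    rw [hi, Matrix.smul_one_map_derivation]
    simp
  let j := μ (γ • 1)
  have hj : j * i = (i - 1) * j := by
    rw [sub_mul, hie, hdγ, one_mul, add_sub_cancel_right]
  have hjp : j ^ p = algebraMap F (Module.End E₀ (Fin N → E)) c := by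
    rw [← map_pow, smul_pow, one_pow, hc₀, hE, ← IsScalarTower.algebraMap_apply]
  have hpow : ∀ k, j * i ^ k = (i - 1) ^ k * j := fun k =>
    (SemiconjBy.pow_right (show SemiconjBy j i (i - 1) from hj) k)
  have hhj : Commute (i ^ p - i) j := by
    rw [Commute, SemiconjBy, mul_sub, hpow, sub_pow_char_of_commute p (Commute.one_right i), hj]
    simp only [sub_mul, one_pow, one_mul]
    abel
  have hhE : ∀ e : E, Commute (i ^ p - i) (μ (e • 1)) := by
    intro e
    have he : e ∈ Algebra.adjoin E₀ {γ} := htop ▸ trivial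
    clear htop
    induction he using Algebra.adjoin_induction with
    | mem x hx => rw [Set.mem_singleton_iff.1 hx]; exact hhj
    | algebraMap r =>
      rw [hE]
      exact Algebra.commute_algebraMap_right r _
    | add x y _ _ hx hy => rw [add_smul, map_add]; exact hx.add_right hy
    | mul x y _ _ hx hy => rw [mul_smul, hscal]; exact hx.mul_right hy
  have hhX : ∀ X, Commute (i ^ p - i) (μ X) := by
    intro X
    have hrank : Module.finrank F A = Module.finrank E (Matrix (Fin N) (Fin N) E) := by
      rw [Module.finrank_matrix]
      simp [hN]
    have hX : X ∈ Submodule.span E (Set.range ρ) := hA.span_range_eq_top ρ hrank ▸ trivial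
    induction hX using Submodule.span_induction with
    | mem x hx =>
      obtain ⟨a, rfl⟩ := hx
      exact ((hiρ a).pow_left p).sub_left (hiρ a)
    | zero => rw [map_zero]; exact Commute.zero_right _
    | add x y _ _ hx hy => rw [map_add]; exact hx.add_right hy
    | smul e x _ hx => rw [hscal]; exact (hhE e).mul_right hx
  obtain ⟨e, he⟩ := matrixEnd_exists_eq_smul_one hNpos _ hhX
  have hde : d e = 0 := by
    have h1 : Commute i (μ (e • 1)) :=
      he ▸ ((Commute.refl i).pow_right p).sub_right (Commute.refl i)
    have h2 := hie e
    rw [h1.eq, left_eq_add] at h2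
    have h3 := congrFun (LinearMap.congr_fun h2 (Pi.single ⟨0, hNpos⟩ 1)) ⟨0, hNpos⟩
    simpa [μ, Matrix.smul_mulVec] using h3
  obtain ⟨a', rfl⟩ := hker e hde
  have he' : i ^ p - i = algebraMap E₀ _ a' := by
    rw [he]
    exact hE a'
  obtain ⟨y, hy⟩ := hE₀ a'
  let i' := i + algebraMap E₀ _ a'
  have hrel : SymbolRel p y c i' j := by
    refine ⟨fun h0 => hγ 0 ?_, ?_, hjp, ?_⟩
    · rw [h0, map_zero] at hc
      rw [map_zero, eq_zero_of_pow_eq_zero hc]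
    · rw [add_pow_char_of_commute p (Algebra.commute_algebraMap_right a' i), add_sub_add_comm,
        he', IsScalarTower.algebraMap_apply F E₀ (Module.End _ _), hy, map_pow]
      abel
    · rw [mul_add, hj, (Algebra.commute_algebraMap_right a' j).eq, ← add_mul]
      congr 1
      simp only [i']
      abel
  let D := Algebra.adjoin F {i', j}
  let iD : D := ⟨i', Algebra.subset_adjoin (by simp)⟩
  let jD : D := ⟨j, Algebra.subset_adjoin (by simp)⟩
  have hrelD : SymbolRel p y c iD jD :=
    ⟨hrel.ne_zero, Subtype.ext hrel.pow_sub, Subtype.ext hrel.pow_eq, Subtype.ext hrel.mul_eq⟩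
  have htopD : Algebra.adjoin F {iD, jD} = ⊤ := by
    have := Algebra.adjoin_adjoin_coe_preimage (R := F) (s := {i', j})
    convert this using 2
    ext x
    simp [iD, jD, Subtype.ext_iff]
  have hcyc : IsCyclicPAlg p F D := ⟨y, c, hrelD.isCyclicAlgWith htopD⟩
  have hcomm : ∀ (a : A) (x : D), Commute (((μ.restrictScalars F).comp ρ) a) (D.val x) := by
    intro a x
    have : D ≤ Subalgebra.centralizer F {μ (ρ a)} := by
      refine Algebra.adjoin_le ?_
      rintro z (rfl | rfl)
      · rw [SetLike.mem_coe, Subalgebra.mem_centralizer_iff]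
        rintro _ rfl
        exact ((hiρ a).add_left (Algebra.commute_algebraMap_left a' _)).symm
      · rw [SetLike.mem_coe, Subalgebra.mem_centralizer_iff]
        rintro _ rfl
        simp only [j, ← map_mul]
        simp
    exact (Subalgebra.mem_centralizer_iff F).1 (this x.2) _ rfl
  refine ⟨D, inferInstance, inferInstance, hcyc, ?_⟩
  refine (hA.tensorProduct hcyc.isCSA).splitsOver_of_end
    (Algebra.TensorProduct.lift ((μ.restrictScalars F).comp ρ) D.val hcomm) (N := N * p) ?_ ?_
  · have hD : Module.finrank F D = p ^ 2 := (hrelD.isCyclicAlgWith htopD).2.1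
    have : Module.Free F D := Module.Free.of_divisionRing F D
    rw [Module.finrank_tensorProduct, hD, ← hN]
    ring
  · rw [Module.finrank_pi_fintype]
    simp [hdeg]

end Albert

section AlbertInduction

variable {F A : Type} [Field F] [Ring A] [Algebra F A]

theorem SplitsOver.map {E E' : Type} [Field E] [Algebra F E] [Field E'] [Algebra F E']
    (h : SplitsOver F A E) (φ : E →ₐ[F] E') : SplitsOver F A E' := by
  obtain ⟨N, hN, ⟨ρ⟩⟩ := h
  exact ⟨N, hN, ⟨φ.mapMatrix.comp ρ⟩⟩

theorem IsCSA.isSplitAlg_of_splitsOver (hA : IsCSA F A) (h : SplitsOver F A F) :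
    IsSplitAlg F A := by
  obtain ⟨N, hN, ⟨ρ⟩⟩ := h
  have hpos := hA.pos_of_sq_eq hN
  have : Nonempty (Fin N) := ⟨⟨0, hpos⟩⟩
  have := hA.2.1
  have := hA.2.2
  have hrank : Module.finrank F A = Module.finrank F (Matrix (Fin N) (Fin N) F) := by
    rw [Module.finrank_matrix]
    simp [hN]
  have hinj : Function.Injective ρ := ρ.toRingHom.injective
  have hsurj : Function.Surjective ρ :=
    (LinearMap.injective_iff_surjective_of_finrank_eq_finrank (f := ρ.toLinearMap) hrank).1 hinj
  exact ⟨N, hpos, ⟨AlgEquiv.ofBijective ρ ⟨hinj, hsurj⟩⟩⟩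

theorem IntermediateField.exists_algebraMap_eq_pow_of_mem_adjoin {p : ℕ} [Fact p.Prime]
    [CharP F p] {κ : Type} [Field κ] [Algebra F κ] {s : Set κ}
    (hs : ∀ x ∈ s, ∃ y : F, algebraMap F κ y = x ^ p) {x : κ}
    (hx : x ∈ IntermediateField.adjoin F s) : ∃ y : F, algebraMap F κ y = x ^ p := by
  have : CharP κ p := charP_of_injective_algebraMap (algebraMap F κ).injective p
  induction hx using IntermediateField.adjoin_induction with
  | mem x hx => exact hs x hx
  | algebraMap x => exact ⟨x ^ p, map_pow _ _ _⟩
  | add x y _ _ hx hy =>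
    obtain ⟨a, ha⟩ := hx
    obtain ⟨b, hb⟩ := hy
    exact ⟨a + b, by rw [map_add, ha, hb, add_pow_char]⟩
  | inv x _ hx =>
    obtain ⟨a, ha⟩ := hx
    exact ⟨a⁻¹, by rw [map_inv₀, ha, inv_pow]⟩
  | mul x y _ _ hx hy =>
    obtain ⟨a, ha⟩ := hx
    obtain ⟨b, hb⟩ := hy
    exact ⟨a * b, by rw [map_mul, ha, hb, mul_pow]⟩

theorem IsCSA.symbolLengthLE_of_splitsOver {p : ℕ} [Fact p.Prime] [CharP F p] (r : ℕ)
    {A κ : Type} [Ring A] [Algebra F A] [Field κ] [Algebra F κ] (hA : IsCSA F A)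
    (hs : SplitsOver F A κ) (g : Fin r → κ) (hg : ∀ i, ∃ y : F, algebraMap F κ y = g i ^ p)
    (htop : IntermediateField.adjoin F (Set.range g) = ⊤) : SymbolLengthLE p F A r := by
  induction r generalizing A κ with
  | zero =>
    rw [Set.range_eq_empty, IntermediateField.adjoin_empty] at htop
    let e : κ ≃ₐ[F] F := IntermediateField.topEquiv.symm.trans
      ((IntermediateField.equivOfEq htop.symm).trans (IntermediateField.botEquiv F κ))
    exact SymbolLengthLE.of_isSplitAlg (hA.isSplitAlg_of_splitsOver (hs.map e.toAlgHom)) 0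
  | succ r ih =>
    have hp : p.Prime := Fact.out
    let E₀ := IntermediateField.adjoin F (Set.range fun k : Fin r => g k.castSucc)
    have hmem : ∀ k : Fin r, g k.castSucc ∈ E₀ := fun k =>
      IntermediateField.subset_adjoin F _ ⟨k, rfl⟩
    have hsub : ∀ K : IntermediateField F κ, E₀ ≤ K → g (Fin.last r) ∈ K → K = ⊤ := by
      intro K hK hl
      rw [eq_top_iff, ← htop, IntermediateField.adjoin_le_iff]
      rintro _ ⟨k, rfl⟩
      induction k using Fin.lastCases with
      | last => exact hl
      | cast k => exact hK (hmem k)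
    by_cases hγ : g (Fin.last r) ∈ E₀
    · exact (ih hA hs (fun k => g k.castSucc) (fun k => hg _) (hsub _ le_rfl hγ)).mono
        (Nat.le_succ r)
    · obtain ⟨c, hc⟩ := hg (Fin.last r)
      have hE₀ : ∀ x : E₀, ∃ y : F, algebraMap F E₀ y = x ^ p := by
        intro x
        obtain ⟨y, hy⟩ := IntermediateField.exists_algebraMap_eq_pow_of_mem_adjoin
          (by rintro _ ⟨k, rfl⟩; exact hg _) x.2
        exact ⟨y, Subtype.ext hy⟩
      have hintegral : IsIntegral E₀ (g (Fin.last r)) := by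
        refine IsIntegral.of_pow hp.pos ?_
        rw [← hc, IsScalarTower.algebraMap_apply F E₀ κ]
        exact isIntegral_algebraMap
      have htop' : Algebra.adjoin E₀ {g (Fin.last r)} = ⊤ := by
        rw [← IntermediateField.adjoin_simple_toSubalgebra_of_isAlgebraic hintegral.isAlgebraic]
        have : (IntermediateField.adjoin E₀ {g (Fin.last r)}).restrictScalars F = ⊤ := by
          refine hsub _ (fun x hx => ?_) ?_
          · exact (IntermediateField.adjoin E₀ {g (Fin.last r)}).algebraMap_mem ⟨x, hx⟩
          · exact IntermediateField.mem_adjoin_simple_self E₀ _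
        rw [eq_top_iff]
        intro x _
        have hx : x ∈ (IntermediateField.adjoin E₀ {g (Fin.last r)}).restrictScalars F :=
          this ▸ trivial
        exact hx
      obtain ⟨D, iR, iA, hD, hsD⟩ := hA.exists_isCyclicPAlg_splitsOver hs hc.symm
        (fun x hx => hγ (hx ▸ x.2)) htop' hE₀
      refine SymbolLengthLE.of_tensor hD (ih (hA.tensorProduct hD.isCSA) hsD
        (fun k => ⟨g k.castSucc, hmem k⟩) (fun k => hE₀ _) ?_)
      refine IntermediateField.map_injective E₀.val ?_
      rw [IntermediateField.adjoin_map, ← Set.range_comp, ← AlgHom.fieldRange_eq_map,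
        IntermediateField.fieldRange_val]
      rfl

end AlbertInduction

section Descent

variable {F A : Type} [Field F] [Ring A] [Algebra F A]

theorem IsCSA.finrank_eq_finrank_matrix (hA : IsCSA F A) (E : Type) [Field E] {N : ℕ}
    (hN : N * N = Module.finrank F A) :
    Module.finrank F A = Module.finrank E (Matrix (Fin N) (Fin N) E) := by
  have := hA.2.2
  rw [Module.finrank_matrix]
  simp [hN]

theorem IsCSA.injective_sum_mulVec (hA : IsCSA F A) {E : Type} [Field E] [Algebra F E] {N R s : ℕ}
    (hN : N * N = Module.finrank F A) (ρ : A →ₐ[F] Matrix (Fin N) (Fin N) E)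
    (τ : A →ₐ[F] Matrix (Fin R) (Fin R) E) (θ : Fin s → Matrix (Fin R) (Fin N) E)
    (hθ : ∀ k a, τ a * θ k = θ k * ρ a) (hind : LinearIndependent E θ) (v : Fin s → Fin N → E)
    (hv : ∑ k, (θ k).mulVec (v k) = 0) : v = 0 := by
  have : Nonempty (Fin N) := ⟨⟨0, hA.pos_of_sq_eq hN⟩⟩
  have key : ∀ X : Matrix (Fin N) (Fin N) E, ∑ k, (θ k).mulVec (X.mulVec (v k)) = 0 := by
    intro X
    have hX : X ∈ Submodule.span E (Set.range ρ) :=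
      hA.span_range_eq_top ρ (hA.finrank_eq_finrank_matrix E hN) ▸ trivial
    induction hX using Submodule.span_induction with
    | mem x hx =>
      obtain ⟨a, rfl⟩ := hx
      have h1 := congrArg (τ a).mulVec hv
      rw [Matrix.mulVec_zero, Matrix.mulVec_sum] at h1
      rw [← h1]
      refine Finset.sum_congr rfl fun k _ => ?_
      rw [Matrix.mulVec_mulVec, Matrix.mulVec_mulVec, hθ]
    | zero => simp
    | add x y _ _ hx hy =>
      simp only [Matrix.add_mulVec, Matrix.mulVec_add, Finset.sum_add_distrib, hx, hy, add_zero]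
    | smul e x _ hx =>
      simp only [Matrix.smul_mulVec, Matrix.mulVec_smul, ← Finset.smul_sum, hx, smul_zero]
  ext k b
  have h2 : ∑ k, v k b • θ k = 0 := by
    ext r a
    have := congrFun (key (Matrix.single a b 1)) r
    rw [Finset.sum_apply] at this
    rw [Matrix.sum_apply, Matrix.zero_apply]
    refine (Finset.sum_congr rfl fun k _ => ?_).trans this
    have h3 : (Matrix.single a b (1 : E)).mulVec (v k) = Pi.single a (v k b) := by
      rw [Matrix.single_mulVec, one_mul]
      rfl
    rw [h3, Matrix.mulVec_single]
    simp [mul_comm]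
  exact Fintype.linearIndependent_iff.1 hind _ h2 k

theorem IsCSA.mul_le_of_linearIndependent (hA : IsCSA F A) {E : Type} [Field E] [Algebra F E]
    {N R s : ℕ} (hN : N * N = Module.finrank F A) (ρ : A →ₐ[F] Matrix (Fin N) (Fin N) E)
    (τ : A →ₐ[F] Matrix (Fin R) (Fin R) E) (θ : Fin s → Matrix (Fin R) (Fin N) E)
    (hθ : ∀ k a, τ a * θ k = θ k * ρ a) (hind : LinearIndependent E θ) : s * N ≤ R := by
  let f : (Fin s → Fin N → E) →ₗ[E] (Fin R → E) :=
    ∑ k, (θ k).mulVecLin ∘ₗ LinearMap.proj k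
  have hf : Function.Injective f := by
    rw [← LinearMap.ker_eq_bot, LinearMap.ker_eq_bot']
    intro v hv
    exact hA.injective_sum_mulVec hN ρ τ θ hθ hind v (by simpa [f] using hv)
  simpa [Module.finrank_pi_fintype] using LinearMap.finrank_le_finrank_of_injective hf

theorem IsCSA.exists_intertwiner (hA : IsCSA F A) {E : Type} [Field E] [Algebra F E] {N R : ℕ}
    (hR : 0 < R) (hN : N * N = Module.finrank F A) (ρ : A →ₐ[F] Matrix (Fin N) (Fin N) E)
    (τ : A →ₐ[F] Matrix (Fin R) (Fin R) E) :
    ∃ J : Matrix (Fin R) (Fin N) E, J ≠ 0 ∧ ∀ a, τ a * J = J * ρ a := by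
  have hNpos := hA.pos_of_sq_eq hN
  have : Nonempty (Fin N) := ⟨⟨0, hNpos⟩⟩
  have : Nonempty (Fin R) := ⟨⟨0, hR⟩⟩
  let φ := AlgEquiv.ofBijective _ (hA.baseChangeLift_bijective (E := E) ρ
    (hA.finrank_eq_finrank_matrix E hN))
  let Ψ : Matrix (Fin N) (Fin N) E →ₐ[E] Matrix (Fin R) (Fin R) E :=
    (baseChangeLift E τ).comp φ.symm.toAlgHom
  have hΨ : ∀ a, Ψ (ρ a) = τ a := by
    intro a
    have : φ.symm (ρ a) = 1 ⊗ₜ a := by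
      rw [AlgEquiv.symm_apply_eq]
      simp [φ]
    change baseChangeLift E τ (φ.symm (ρ a)) = _
    rw [this]
    simp
  let o : Fin N := ⟨0, hNpos⟩
  have hne : Ψ (Matrix.single o o 1) ≠ 0 := by
    rw [Ne, map_eq_zero_iff Ψ Ψ.toRingHom.injective]
    intro h
    simpa using congrFun (congrFun h o) o
  obtain ⟨r, c, hrc⟩ : ∃ r c, Ψ (Matrix.single o o 1) r c ≠ 0 := by
    by_contra! h
    exact hne (Matrix.ext h)
  refine ⟨Matrix.of fun r k => Ψ (Matrix.single k o 1) r c, fun h => ?_, fun a => ?_⟩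
  · exact hrc (congrFun (congrFun h r) o)
  · ext r k
    have h1 : (τ a * Ψ (Matrix.single k o 1)) r c = ∑ u, ρ a u k * Ψ (Matrix.single u o 1) r c := by
      rw [← hΨ, ← map_mul, Matrix.mul_single_one, map_sum, Matrix.sum_apply]
      simp only [map_smul, Matrix.smul_apply, smul_eq_mul]
    rw [Matrix.mul_apply] at h1
    rw [Matrix.mul_apply, Matrix.mul_apply]
    refine h1.trans (Finset.sum_congr rfl fun u _ => mul_comm _ _)

end Descent

section DescentDerivation

variable {F A : Type} [Field F] [Ring A] [Algebra F A]

theorem AlgHom.exists_matrix_descent {E₀ E n : Type} [Field E₀] [Field E] [Algebra F E₀]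
    [Algebra F E] [Fintype n] [DecidableEq n] (ι : E₀ →ₐ[F] E) (f : A →ₐ[F] Matrix n n E)
    (hf : ∀ a k l, ∃ x, ι x = f a k l) : Nonempty (A →ₐ[F] Matrix n n E₀) := by
  have hinj : Function.Injective (ι.mapMatrix (m := n)) := fun X Y h =>
    Matrix.ext fun k l => ι.toRingHom.injective (congrFun (congrFun h k) l)
  refine ⟨(AlgEquiv.ofInjective ι.mapMatrix hinj).symm.toAlgHom.comp
    (f.codRestrict (ι.mapMatrix (m := n)).range fun a => ?_)⟩
  choose x hx using hf a
  exact ⟨Matrix.of x, Matrix.ext hx⟩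

/-- The field of constants of a derivation. -/
def Derivation.constants {K E : Type} [Field K] [Field E] [Algebra K E] (d : Derivation K E E) :
    IntermediateField K E where
  carrier := {x | d x = 0}
  mul_mem' {x y} hx hy := by simp_all
  add_mem' {x y} hx hy := by simp_all
  algebraMap_mem' r := by simp
  inv_mem' x hx := by simp_all [Derivation.leibniz_inv]

theorem Matrix.exists_isUnit_submatrix {E : Type} [Field E] {R N : ℕ}
    (J : Matrix (Fin R) (Fin N) E) (hJ : ∀ v, J.mulVec v = 0 → v = 0) :
    ∃ s : Fin N → Fin R, IsUnit (J.submatrix s id) := by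
  have hrank : J.rank = N := by
    have h1 : LinearIndependent E J.col := by
      rw [← Matrix.mulVec_injective_iff]
      exact (injective_iff_map_eq_zero J.mulVecLin).2 hJ
    simpa using h1.rank_matrix
  obtain ⟨κ, a, ha, hspan, hind⟩ := exists_linearIndependent' E J.row
  have : Finite κ := Finite.of_injective a ha
  have := Fintype.ofFinite κ
  have hcard : Fintype.card κ = N := by
    rw [← hrank, Matrix.rank_eq_finrank_span_row, ← hspan, finrank_span_eq_card hind]
  let e : Fin N ≃ κ := (Fintype.equivFinOfCardEq hcard).symm
  refine ⟨a ∘ e, ?_⟩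
  rw [← Matrix.linearIndependent_rows_iff_isUnit]
  exact hind.comp e e.injective

theorem IsCSA.exists_splitsOver_ne_top (hA : IsCSA F A) {K E : Type} [Field K] [Field E]
    [Algebra F K] [Algebra K E] [Algebra F E] [IsScalarTower F K E] {m N R : ℕ} (hR : 0 < R)
    (hN : N * N = Module.finrank F A) (hRm : R ≤ m * N) (τ : A →ₐ[F] Matrix (Fin R) (Fin R) K)
    (ρ : A →ₐ[F] Matrix (Fin N) (Fin N) E) (d : Fin m → Derivation K E E)
    (hd : LinearIndependent E d) : ∃ L : IntermediateField K E, L ≠ ⊤ ∧ SplitsOver F A L := by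
  have hNpos := hA.pos_of_sq_eq hN
  let τ' : A →ₐ[F] Matrix (Fin R) (Fin R) E := (IsScalarTower.toAlgHom F K E).mapMatrix.comp τ
  obtain ⟨J, hJ0, hJ⟩ := hA.exists_intertwiner hR hN ρ τ'
  have hinj : ∀ v, J.mulVec v = 0 → v = 0 := by
    intro v hv
    have := hA.injective_sum_mulVec hN ρ τ' (fun _ : Fin 1 => J) (fun _ => hJ)
      (linearIndependent_unique_iff.2 hJ0) (fun _ => v) (by simpa using hv)
    exact congrFun this 0
  choose T hT using fun k => hA.exists_map_derivation_eq hN ρ ((d k).restrictScalars F)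
  replace hT : ∀ k a, (ρ a).map (d k) = T k * ρ a - ρ a * T k := hT
  -- `T` and the action of `d k` on `J` combine into further intertwiners.
  have hJd : ∀ (δ : Derivation K E E) a, τ' a * J.map δ = J.map δ * ρ a + J * (ρ a).map δ := by
    intro δ a
    ext r c
    have h1 := congrArg δ (congrFun (congrFun (hJ a) r) c)
    rw [Matrix.mul_apply, Matrix.mul_apply, map_sum, map_sum] at h1
    rw [Matrix.add_apply, Matrix.mul_apply, Matrix.mul_apply, Matrix.mul_apply,
      ← Finset.sum_add_distrib]
    refine Eq.trans ?_ (h1.trans ?_)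
    · refine Finset.sum_congr rfl fun k _ => ?_
      simp [τ', IsScalarTower.toAlgHom]
    · refine Finset.sum_congr rfl fun k _ => ?_
      simp
      ring
  let θ : Fin (m + 1) → Matrix (Fin R) (Fin N) E := Fin.cons J fun k => J.map (d k) + J * T k
  have hθ : ∀ k a, τ' a * θ k = θ k * ρ a := by
    intro k a
    induction k using Fin.cases with
    | zero => exact hJ a
    | succ k =>
      simp only [θ, Fin.cons_succ, Matrix.mul_add, Matrix.add_mul, hJd, hT,
        Matrix.mul_sub, ← Matrix.mul_assoc, hJ]
      abel
  have hdep : ¬ LinearIndependent E θ := fun h => by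
    have := hA.mul_le_of_linearIndependent hN ρ τ' θ hθ h
    nlinarith
  obtain ⟨g, hg, hg0⟩ := Fintype.not_linearIndependent_iff.1 hdep
  rw [Fin.sum_univ_succ] at hg
  simp only [θ, Fin.cons_zero, Fin.cons_succ] at hg
  let D : Derivation K E E := ∑ k, g k.succ • d k
  let T' : Matrix (Fin N) (Fin N) E := g 0 • 1 + ∑ k : Fin m, g k.succ • T k
  have hDx : ∀ x, D x = ∑ k, g k.succ * d k x := fun x => by
    have := congrFun (map_sum (Derivation.coeFnAddMonoidHom (R := K) (A := E) (M := E))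
      (fun k => g k.succ • d k) Finset.univ) x
    rw [Finset.sum_apply] at this
    exact this
  have hD : D ≠ 0 := by
    intro h
    have h1 := Fintype.linearIndependent_iff.1 hd _ h
    have h2 : g 0 • J = 0 := by simpa [h1] using hg
    obtain ⟨k, hk⟩ := hg0
    induction k using Fin.cases with
    | zero => exact hk ((smul_eq_zero.1 h2).resolve_right hJ0)
    | succ k => exact hk (h1 k)
  have hmapD : ∀ {u v : Type} (X : Matrix u v E), X.map D = ∑ k, g k.succ • X.map (d k) := by
    intro u v X
    ext r c
    simp [hDx, Matrix.sum_apply]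
  have hJD : J.map D + J * T' = 0 := by
    rw [← hg, hmapD, Matrix.mul_add, Matrix.mul_sum]
    simp only [smul_add, Finset.sum_add_distrib, Matrix.mul_smul, Matrix.mul_one]
    abel
  have hρD : ∀ a, (ρ a).map D = T' * ρ a - ρ a * T' := by
    intro a
    rw [hmapD]
    simp only [T', add_mul, mul_add, Finset.sum_mul, Finset.mul_sum, hT, smul_sub,
      Finset.sum_sub_distrib, smul_mul_assoc, mul_smul_comm, one_mul, mul_one]
    abel
  obtain ⟨s, hP⟩ := J.exists_isUnit_submatrix hinj
  set P := J.submatrix s id with hPdef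
  have hPD : P.map D = - (P * T') := by
    have h1 := congrArg (fun X => Matrix.submatrix X s id) (eq_neg_of_add_eq_zero_left hJD)
    ext r c
    have h2 := congrFun (congrFun h1 r) c
    simpa [Matrix.mul_apply, hPdef] using h2
  obtain ⟨u, hu⟩ := hP
  let ρ' : A →ₐ[F] Matrix (Fin N) (Fin N) E :=
    { toFun := fun a => u * ρ a * (u⁻¹ : (Matrix (Fin N) (Fin N) E)ˣ)
      map_one' := by simp
      map_zero' := by simp
      map_mul' := fun a b => by simp [mul_assoc]
      map_add' := fun a b => by simp [mul_add, add_mul]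
      commutes' := fun r => by
        rw [AlgHom.commutes, ← Algebra.commutes, mul_assoc, Units.mul_inv, mul_one] }
  have hρ' : ∀ a, (ρ' a).map D = 0 := by
    intro a
    have h1 : ρ' a * P = P * ρ a := by simp [ρ', ← hu, mul_assoc]
    have h2 := congrArg (fun X : Matrix (Fin N) (Fin N) E => X.map D) h1
    simp only [Matrix.map_derivation_mul, hPD, hρD] at h2
    have h3 : (ρ' a).map D * P = 0 := by
      have h4 : ρ' a * (P * T') = P * ρ a * T' := by rw [← mul_assoc, h1]
      rw [mul_neg, h4, mul_sub, neg_mul, ← mul_assoc, ← mul_assoc] at h2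
      have h5 := sub_eq_zero.2 h2
      rw [← h5]
      abel
    rw [← hu] at h3
    simpa using h3
  refine ⟨D.constants, fun h => hD (Derivation.ext fun x => ?_), N, hN, ?_⟩
  · have : x ∈ D.constants := h ▸ trivial
    exact this
  · refine AlgHom.exists_matrix_descent (D.constants.val.restrictScalars F) ρ' fun a k l => ?_
    exact ⟨⟨ρ' a k l, congrFun (congrFun (hρ' a) k) l⟩, rfl⟩

end DescentDerivation

section FewGenerators

theorem exists_adjoin_eq_top_of_finrank_kaehlerDifferential_le {p : ℕ} [Fact p.Prime]
    {K E : Type} [Field K] [Field E] [Algebra K E] [CharP K p] [FiniteDimensional K E]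
    (hE : ∀ x : E, ∃ y : K, algebraMap K E y = x ^ p) {r : ℕ}
    (hr : Module.finrank E (Ω[E⁄K]) ≤ r) :
    ∃ g : Fin r → E, IntermediateField.adjoin K (Set.range g) = ⊤ := by
  have hp : p.Prime := Fact.out
  obtain ⟨κ, a, ha, hspan, hind⟩ := exists_linearIndependent' E (KaehlerDifferential.D K E)
  have : Finite κ := hind.finite
  have := Fintype.ofFinite κ
  rw [KaehlerDifferential.span_range_derivation] at hspan
  have hcard : Fintype.card κ ≤ r := by
    rw [← finrank_span_eq_card hind, hspan, finrank_top]
    exact hr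
  obtain ⟨f⟩ := Function.Embedding.nonempty_of_card_le (α := κ) (β := Fin r) (by simpa using hcard)
  let g : Fin r → E := Function.extend f a 0
  let L := IntermediateField.adjoin K (Set.range g)
  have hmem : ∀ k, a k ∈ L := fun k =>
    IntermediateField.subset_adjoin K _ ⟨f k, f.injective.extend_apply a 0 k⟩
  have hℓ : KaehlerDifferential.map K L E E = 0 := by
    refine LinearMap.ext_on_range hspan fun k => ?_
    have h1 : KaehlerDifferential.D L E (algebraMap L E ⟨a k, hmem k⟩) = 0 :=
      Derivation.map_algebraMap _ _
    rw [Function.comp_apply, KaehlerDifferential.map_D]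
    exact h1
  have hunr : Algebra.FormallyUnramified L E := by
    rw [Algebra.formallyUnramified_iff]
    refine ⟨fun x y => ?_⟩
    have h0 : ∀ x : Ω[E⁄L], x = 0 := by
      intro x
      have hx : x ∈ Submodule.span E (Set.range (KaehlerDifferential.D L E)) :=
        KaehlerDifferential.span_range_derivation L E ▸ trivial
      induction hx using Submodule.span_induction with
      | mem x hx =>
        obtain ⟨z, rfl⟩ := hx
        have h2 := LinearMap.congr_fun hℓ (KaehlerDifferential.D K E z)
        rwa [KaehlerDifferential.map_D] at h2
      | zero => rfl
      | add x y _ _ hx hy => rw [hx, hy, add_zero]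
      | smul e x _ hx => rw [hx, smul_zero]
    rw [h0 x, h0 y]
  have : FiniteDimensional L E := FiniteDimensional.right K L E
  have : Algebra.IsSeparable L E := Algebra.FormallyUnramified.isSeparable L E
  have : CharP L p := charP_of_injective_algebraMap (algebraMap K L).injective p
  have : ExpChar L p := ExpChar.prime hp
  have : IsPurelyInseparable L E := by
    rw [isPurelyInseparable_iff_pow_mem L p]
    intro x
    obtain ⟨y, hy⟩ := hE x
    exact ⟨1, algebraMap K L y, by rw [pow_one, ← hy, ← IsScalarTower.algebraMap_apply]⟩
  refine ⟨g, eq_top_iff.2 fun x _ => ?_⟩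
  obtain ⟨y, rfl⟩ := IsPurelyInseparable.surjective_algebraMap_of_isSeparable L E x
  exact y.2

variable {F A : Type} [Field F] [Ring A] [Algebra F A]

theorem IsCSA.exists_splitsOver_adjoin_eq_top {p : ℕ} [Fact p.Prime] [CharP F p]
    (hA : IsCSA F A) {K κ : Type} [Field K] [Field κ] [Algebra F K] [Algebra K κ] [Algebra F κ]
    [IsScalarTower F K κ] [FiniteDimensional K κ]
    (hκ : ∀ x : κ, ∃ y : F, algebraMap F κ y = x ^ p) {m N R : ℕ} (hm : 0 < m) (hR : 0 < R)
    (hN : N * N = Module.finrank F A) (hRm : R ≤ m * N) (τ : A →ₐ[F] Matrix (Fin R) (Fin R) K)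
    (hs : SplitsOver F A κ) :
    ∃ E : IntermediateField K κ, SplitsOver F A E ∧
      ∃ g : Fin (m - 1) → E, IntermediateField.adjoin K (Set.range g) = ⊤ := by
  have : CharP K p := charP_of_injective_algebraMap (algebraMap F K).injective p
  have hex : ∃ n, ∃ E : IntermediateField K κ, SplitsOver F A E ∧ Module.finrank K E = n :=
    ⟨_, ⊤, hs.map ((IntermediateField.topEquiv (F := K) (E := κ)).symm.toAlgHom.restrictScalars F),
      rfl⟩
  classical
  obtain ⟨E, hE, hEn⟩ := Nat.find_spec hex
  refine ⟨E, hE, exists_adjoin_eq_top_of_finrank_kaehlerDifferential_le (p := p) (fun x => ?_) ?_⟩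
  · obtain ⟨y, hy⟩ := hκ x
    refine ⟨algebraMap F K y, Subtype.ext ?_⟩
    rw [SubmonoidClass.coe_pow, ← hy, IsScalarTower.algebraMap_apply F K κ]
    rfl
  by_contra hlt
  have hlt' : m ≤ Module.finrank E (Derivation K E E) := by
    rw [← (KaehlerDifferential.linearMapEquivDerivation K E (M := E)).finrank_eq,
      Subspace.dual_finrank_eq]
    omega
  obtain ⟨N', hN', ⟨ρ⟩⟩ := hE
  obtain rfl : N' = N := Nat.mul_self_inj.1 (hN'.trans hN.symm)
  obtain ⟨d, hd⟩ := exists_linearIndependent_of_le_finrank hlt'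
  obtain ⟨L, hL, hsL⟩ := hA.exists_splitsOver_ne_top hR hN hRm τ ρ d hd
  refine Nat.find_min hex (m := Module.finrank K L) ?_ ⟨IntermediateField.lift L, ?_, ?_⟩
  · rw [← hEn]
    refine lt_of_le_of_ne (Submodule.finrank_le (Subalgebra.toSubmodule L.toSubalgebra))
      fun h => hL ?_
    refine IntermediateField.eq_of_le_of_finrank_eq le_top ?_
    rw [h, IntermediateField.finrank_top']
  · exact hsL.map ((IntermediateField.liftAlgEquiv L).toAlgHom.restrictScalars F)
  · exact (IntermediateField.liftAlgEquiv L).toLinearEquiv.finrank_eq.symm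

end FewGenerators

section CyclicShift

variable {p : ℕ} [Fact p.Prime] {n : Type}

theorem Fin.eq_const_of_add_right_eq {I : Fin p → n} {k l : Fin p} (hkl : k ≠ l)
    (h : (fun x => I (x + k)) = fun x => I (x + l)) : ∃ c, I = fun _ => c := by
  have hp : p.Prime := Fact.out
  let d := k - l
  have hd : d ≠ 0 := sub_ne_zero.2 hkl
  have h1 : ∀ x, I (x + d) = I x := fun x => by
    have := congrFun h (x - l)
    simp only [sub_add_cancel] at this
    rw [← this]
    congr 1
    simp only [d]
    abel
  refine ⟨I 0, funext fun x => ?_⟩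
  have hx : x ∈ AddSubgroup.zmultiples d := by
    rw [zmultiples_eq_top_of_prime_card (p := p) (by simp) hd]
    trivial
  obtain ⟨z, rfl⟩ := AddSubgroup.mem_zmultiples_iff.1 hx
  clear hx
  induction z using Int.induction_on with
  | zero => simp
  | succ i ih => rw [add_zsmul, one_zsmul, h1, ih]
  | pred i ih => rw [← ih, ← h1 (_ • d), sub_zsmul, one_zsmul, neg_add_cancel_right]

/-- A fundamental domain for the cyclic shift on non-constant words of prime length. -/
theorem Fin.exists_weight (p : ℕ) [Fact p.Prime] (n S : Type) [Semiring S] :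
    ∃ w : (Fin p → n) → S, (∀ c, w (fun _ => c) = 0) ∧
      ∀ I : Fin p → n, (¬ ∃ c, I = fun _ => c) → ∑ k : Fin p, w (fun x => I (x + k)) = 1 := by
  classical
  let r : Setoid (Fin p → n) :=
    { r := fun I J => ∃ k : Fin p, J = fun x => I (x + k)
      iseqv := ⟨fun I => ⟨0, by simp⟩,
        fun {I J} ⟨k, hk⟩ => ⟨-k, by subst hk; simp⟩,
        fun {I J K} ⟨k, hk⟩ ⟨l, hl⟩ => ⟨l + k, by subst hk; subst hl; simp [add_assoc]⟩⟩ }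
  refine ⟨fun I => if (¬ ∃ c, I = fun _ => c) ∧ (Quotient.mk r I).out = I then 1 else 0,
    fun c => if_neg fun h => h.1 ⟨c, rfl⟩, fun I hI => ?_⟩
  obtain ⟨k₀, hk₀⟩ : ∃ k : Fin p, (Quotient.mk r I).out = fun x => I (x + k) :=
    r.symm (Quotient.mk_out (s := r) I)
  have hcls : ∀ k : Fin p, Quotient.mk r (fun x => I (x + k)) = Quotient.mk r I := fun k =>
    Quotient.sound (r.symm ⟨k, rfl⟩)
  rw [Finset.sum_eq_single k₀]
  · refine if_pos ⟨fun ⟨c, hc⟩ => hI ⟨c, funext fun x => ?_⟩, ?_⟩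
    · simpa using congrFun hc (x - k₀)
    · rw [hcls, hk₀]
  · intro k _ hk
    refine if_neg fun h => hI (Fin.eq_const_of_add_right_eq hk ?_)
    rw [← h.2, hcls, hk₀]
  · simp

theorem Fin.sum_eq_sum_const [Fintype n] {S : Type} [CommRing S] [CharP S p]
    (h : (Fin p → n) → S) (hh : ∀ I k, h (fun x => I (x + k)) = h I) :
    ∑ I, h I = ∑ c, h fun _ => c := by
  classical
  have hp : p.Prime := Fact.out
  have : NeZero p := ⟨hp.ne_zero⟩
  obtain ⟨w, hw0, hw⟩ := Fin.exists_weight p n S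
  have h1 : ∑ I, (∑ k : Fin p, h I * w fun x => I (x + k)) = 0 := by
    rw [Finset.sum_comm]
    have h2 : ∀ k : Fin p, ∑ I, h I * w (fun x => I (x + k)) = ∑ I, h I * w I := by
      intro k
      let e : (Fin p → n) ≃ (Fin p → n) := (Equiv.addRight k).symm.arrowCongr (Equiv.refl n)
      refine Fintype.sum_equiv e _ _ fun I => ?_
      have : e I = fun x => I (x + k) := rfl
      rw [this, hh]
    simp [h2]
  have h3 : ∀ I, h I = (∑ k : Fin p, h I * w fun x => I (x + k)) +
      if ∃ c, I = fun _ => c then h I else 0 := by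
    intro I
    split_ifs with hI
    · obtain ⟨c, rfl⟩ := hI
      simp [hw0]
    · rw [← Finset.mul_sum, hw I hI]
      simp
  rw [Finset.sum_congr rfl fun I _ => h3 I, Finset.sum_add_distrib, h1, zero_add,
    ← Finset.sum_filter]
  symm
  refine Finset.sum_bij (fun c _ => fun _ => c) ?_ ?_ ?_ ?_
  · intro c _
    simp only [Finset.mem_filter, Finset.mem_univ, true_and]
    exact ⟨c, rfl⟩
  · intro a _ b _ hab
    exact congrFun hab 0
  · intro I hI
    obtain ⟨c, rfl⟩ := (Finset.mem_filter.1 hI).2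
    exact ⟨c, by simp, rfl⟩
  · simp

end CyclicShift

section Intertwiner

variable {F A : Type} [Field F] [Ring A] [Algebra F A]

theorem IsCSA.exists_isUnit_intertwiner (hA : IsCSA F A) {E : Type} [Field E] [Algebra F E]
    {ι : Type} [Fintype ι] [DecidableEq ι]
    (hN : Fintype.card ι * Fintype.card ι = Module.finrank F A)
    (ρ τ : A →ₐ[F] Matrix ι ι E) :
    ∃ J : Matrix ι ι E, IsUnit J ∧ ∀ a, τ a * J = J * ρ a := by
  let e := Fintype.equivFin ι
  let r : Matrix ι ι E ≃ₐ[F] Matrix (Fin (Fintype.card ι)) (Fin (Fintype.card ι)) E :=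
    Matrix.reindexAlgEquiv F E e
  let ρ' := r.toAlgHom.comp ρ
  let τ' := r.toAlgHom.comp τ
  obtain ⟨J, hJ0, hJ⟩ := hA.exists_intertwiner (hA.pos_of_sq_eq hN) hN ρ' τ'
  have hinj : Function.Injective J.mulVec := by
    intro v w hvw
    have h1 := hA.injective_sum_mulVec hN ρ' τ' (fun _ : Fin 1 => J) (fun _ => hJ)
      (LinearIndependent.of_subsingleton 0 hJ0) (fun _ => v - w)
      (by simp [Matrix.mulVec_sub, hvw])
    exact sub_eq_zero.1 (congrFun h1 0)
  have hu : IsUnit J := Matrix.mulVec_injective_iff_isUnit.1 hinj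
  refine ⟨r.symm J, hu.map r.symm, fun a => r.injective ?_⟩
  rw [map_mul, map_mul, AlgEquiv.apply_symm_apply]
  exact hJ a

end Intertwiner

section FrobeniusDescent

variable {F A : Type} [Field F] [Ring A] [Algebra F A]

/-- A finite-dimensional `F`-form of the Frobenius twist of a split representation yields a
split representation whose entries are `p`-th roots of elements of `F`. -/
theorem IsCSA.exists_algHom_pow_mem (hA : IsCSA F A) {p : ℕ} [Fact p.Prime] [CharP F p]
    {Ω : Type} [Field Ω] [Algebra F Ω] [CharP Ω p] [PerfectRing Ω p] {N : ℕ}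
    (hN : N * N = Module.finrank F A) (ρ : A →ₐ[F] Matrix (Fin N) (Fin N) Ω)
    (U : Submodule F (Fin N → Ω)) (hU0 : U ≠ ⊥)
    (hU : ∀ a, ∀ u ∈ U, ((ρ a).map (frobenius Ω p)).mulVec u ∈ U)
    (hind : ∀ (h : ℕ) (u : Fin h → U), LinearIndependent F u → h ≤ N) :
    ∃ ρ' : A →ₐ[F] Matrix (Fin N) (Fin N) Ω,
      ∀ a k l, ∃ y : F, algebraMap F Ω y = ρ' a k l ^ p := by
  have hrank : Module.rank F U ≤ N := rank_le fun s hs => by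
    have := hind _ _ (hs.comp s.equivFin.symm s.equivFin.symm.injective)
    simpa using this
  have hfin : FiniteDimensional F U :=
    Module.rank_lt_aleph0_iff.1 (hrank.trans_lt Cardinal.natCast_lt_aleph0)
  have hle : Module.finrank F U ≤ N := Module.finrank_le_of_rank_le hrank
  have hpos : 0 < Module.finrank F U := by
    rw [Module.finrank_pos_iff, Submodule.nontrivial_iff_ne_bot]
    exact hU0
  let L : A → U →ₗ[F] U := fun a =>
    (((ρ a).map (frobenius Ω p)).mulVecLin.restrictScalars F).restrict (hU a)
  have hL : ∀ a (u : U), (L a u : Fin N → Ω) = ((ρ a).map (frobenius Ω p)).mulVec u :=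
    fun a u => rfl
  have hmap : ∀ a, (ρ a).map (frobenius Ω p) = (frobenius Ω p).mapMatrix (ρ a) := fun a => rfl
  let φ : A →+* Module.End F U :=
    { toFun := L
      map_one' := by
        ext1 u
        apply Subtype.ext
        rw [hL, hmap, map_one, map_one, Matrix.one_mulVec, Module.End.one_apply]
      map_zero' := by
        ext1 u
        apply Subtype.ext
        rw [hL, hmap, map_zero, map_zero, Matrix.zero_mulVec]
        rfl
      map_add' := fun a b => by
        ext1 u
        apply Subtype.ext
        rw [hL, hmap, map_add, map_add, Matrix.add_mulVec]
        rfl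
      map_mul' := fun a b => by
        ext1 u
        apply Subtype.ext
        rw [hL, hmap, map_mul, map_mul, ← Matrix.mulVec_mulVec]
        rfl }
  have hφ : ∀ (c : F) , φ (algebraMap F A c) = algebraMap F _ (c ^ p) := by
    intro c
    ext1 u
    apply Subtype.ext
    change ((ρ (algebraMap F A c)).map (frobenius Ω p)).mulVec u = _
    rw [AlgHom.commutes, Module.algebraMap_end_apply, Matrix.algebraMap_eq_diagonal,
      Matrix.diagonal_map (map_zero _)]
    ext i
    simp [Matrix.mulVec_diagonal, frobenius_def, Algebra.smul_def]
  obtain ⟨h, hh⟩ : ∃ h, Module.finrank F U = h := ⟨_, rfl⟩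
  rw [hh] at hle hpos
  let b := Module.finBasisOfFinrankEq F U hh
  let root : F →+* Ω := ((frobeniusEquiv Ω p).symm : Ω →+* Ω).comp (algebraMap F Ω)
  have hroot : ∀ c, root c ^ p = algebraMap F Ω c := fun c => frobeniusEquiv_symm_pow_p Ω p _
  let ψ : A →+* Matrix (Fin h) (Fin h) Ω :=
    root.mapMatrix.comp ((LinearMap.toMatrixAlgEquiv b : Module.End F U →+* _).comp φ)
  have hψ : ∀ c, ψ (algebraMap F A c) = algebraMap F _ c := by
    intro c
    change root.mapMatrix (LinearMap.toMatrixAlgEquiv b (φ (algebraMap F A c))) = _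
    rw [hφ, AlgEquiv.commutes]
    ext k l
    rw [RingHom.mapMatrix_apply, Matrix.map_apply, Matrix.algebraMap_matrix_apply,
      Matrix.algebraMap_matrix_apply]
    by_cases hkl : k = l
    · simp [hkl, hroot]
    · simp [hkl]
  let ψ' : A →ₐ[F] Matrix (Fin h) (Fin h) Ω := { ψ with commutes' := hψ }
  have : Nonempty (Fin h) := ⟨⟨0, hpos⟩⟩
  have hge : N ≤ h := by
    have := hA.finrank_le Ω ψ'
    rw [← hN] at this
    simp only [Module.finrank_matrix, Fintype.card_fin, Module.finrank_self, mul_one] at this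
    exact Nat.mul_self_le_mul_self_iff.1 this
  have hNh : h = N := le_antisymm hle hge
  subst hNh
  exact ⟨ψ', fun a k l => ⟨_, (hroot _).symm⟩⟩

end FrobeniusDescent

section ShiftForm

variable {F Ω : Type} [Field F] [Field Ω] [Algebra F Ω] {p N : ℕ}

theorem Matrix.comp_map_algebraMap_mulVec {ι : Type} [Fintype ι] (M : Matrix ι ι F) (l : Ω →ₗ[F] F)
    (v : ι → Ω) : (fun i => l ((M.map (algebraMap F Ω)).mulVec v i)) = M.mulVec fun i => l (v i) := by
  ext i
  simp [Matrix.mulVec, dotProduct, ← Algebra.smul_def]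

/-- Restriction to constant words of the `F`-form of functions on words given by `J`. -/
noncomputable def diagMap (J : Matrix (Fin p → Fin N) (Fin p → Fin N) Ω) :
    ((Fin p → Fin N) → F) →ₗ[F] (Fin N → Ω) where
  toFun v i := J.mulVec (fun I => algebraMap F Ω (v I)) fun _ => i
  map_add' v w := by
    ext i
    simp [Matrix.mulVec, dotProduct, mul_add, Finset.sum_add_distrib]
  map_smul' c v := by
    ext i
    simp [Matrix.mulVec, dotProduct, Finset.mul_sum, Algebra.smul_def, mul_left_comm]

theorem diagMap_apply (J : Matrix (Fin p → Fin N) (Fin p → Fin N) Ω)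
    (v : (Fin p → Fin N) → F) (i : Fin N) :
    diagMap J v i = J.mulVec (fun I => algebraMap F Ω (v I)) fun _ => i := rfl

variable [Fact p.Prime] {J : Matrix (Fin p → Fin N) (Fin p → Fin N) Ω}
  {σ : Matrix (Fin p → Fin N) (Fin p → Fin N) F}

theorem shift_pow_mulVec
    (hσ : ∀ v I, J.mulVec ((σ.map (algebraMap F Ω)).mulVec v) I = J.mulVec v fun x => I (x + 1))
    (m : ℕ) (v : (Fin p → Fin N) → Ω) (I : Fin p → Fin N) :
    J.mulVec (((σ ^ m).map (algebraMap F Ω)).mulVec v) I = J.mulVec v fun x => I (x + Fin.ofNat p m) := by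
  induction m generalizing v I with
  | zero => simp [Matrix.map_one]
  | succ m ih =>
    have : Fin.ofNat p (m + 1) = Fin.ofNat p m + 1 := by
      simp [Fin.ext_iff, Fin.val_add]
    rw [pow_succ, Matrix.map_mul, ← Matrix.mulVec_mulVec, ih, hσ, this]
    congr 1
    ext x
    congr 2
    abel

theorem exists_diagMap_ne_zero (hN : 0 < N) (hJ : IsUnit J)
    (hσ : ∀ v I, J.mulVec ((σ.map (algebraMap F Ω)).mulVec v) I = J.mulVec v fun x => I (x + 1)) :
    ∃ v, σ.mulVec v = v ∧ diagMap J v ≠ 0 := by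
  classical
  let f : (Fin p → Fin N) → Ω := Pi.single (fun _ => ⟨0, hN⟩) 1
  obtain ⟨v, hv⟩ := (Matrix.mulVec_surjective_iff_isUnit.2 hJ) f
  have hinv : (σ.map (algebraMap F Ω)).mulVec v = v := by
    apply Matrix.mulVec_injective_iff_isUnit.2 hJ
    ext I
    rw [hσ, hv]
    have : (fun x => I (x + 1)) = (fun _ => (⟨0, hN⟩ : Fin N)) ↔ I = fun _ => ⟨0, hN⟩ :=
      ⟨fun h => funext fun x => by simpa using congrFun h (x - 1), fun h => by subst h; rfl⟩
    simp only [f, Pi.single_apply, this]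
  by_contra! hall
  let b := Module.Basis.ofVectorSpace F Ω
  have hl : ∀ j, diagMap J (fun I => b.coord j (v I)) = 0 := fun j =>
    hall _ (by rw [← Matrix.comp_map_algebraMap_mulVec, hinv])
  let s := Finset.univ.biUnion fun I => (b.repr (v I)).support
  have hexp : ∀ I, v I = ∑ j ∈ s, b.coord j (v I) • b j := by
    intro I
    conv_lhs => rw [← b.linearCombination_repr (v I)]
    rw [Finsupp.linearCombination_apply, Finsupp.sum]
    refine Finset.sum_subset (Finset.subset_biUnion_of_mem (fun I => (b.repr (v I)).support)
      (Finset.mem_univ I)) fun j _ hj => ?_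
    simp [Finsupp.notMem_support_iff.1 hj]
  have h1 : f (fun _ => ⟨0, hN⟩) = 0 := by
    rw [← hv]
    have : J.mulVec v (fun _ => ⟨0, hN⟩) =
        ∑ j ∈ s, b j * diagMap J (fun I => b.coord j (v I)) ⟨0, hN⟩ := by
      simp only [diagMap_apply, Matrix.mulVec, dotProduct, Finset.mul_sum]
      rw [Finset.sum_comm]
      refine Finset.sum_congr rfl fun I _ => ?_
      conv_lhs => rw [hexp I, Finset.mul_sum]
      refine Finset.sum_congr rfl fun j _ => ?_
      rw [Algebra.smul_def]
      ring
    rw [this]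
    exact Finset.sum_eq_zero fun j _ => by rw [hl, Pi.zero_apply, mul_zero]
  simp [f] at h1

theorem le_of_linearIndependent_diagMap [CharP Ω p] (hJ : IsUnit J)
    (hσ : ∀ v I, J.mulVec ((σ.map (algebraMap F Ω)).mulVec v) I = J.mulVec v fun x => I (x + 1))
    {h : ℕ} (v : Fin h → (Fin p → Fin N) → F) (hv : ∀ i, σ.mulVec (v i) = v i)
    (hind : LinearIndependent F fun i => diagMap J (v i)) : h ≤ N := by
  classical
  have hp : p.Prime := Fact.out
  suffices hΩ : LinearIndependent Ω fun i => diagMap J (v i) by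
    simpa using hΩ.fintype_card_le_finrank
  rw [Fintype.linearIndependent_iff]
  intro ω hω i₀
  by_contra hi₀
  -- the combination of the words is killed by restriction to constant words, hence is a trace
  let vΩ : (Fin p → Fin N) → Ω := fun I => ∑ i, ω i * algebraMap F Ω (v i I)
  have hvΩ : (σ.map (algebraMap F Ω)).mulVec vΩ = vΩ := by
    ext I
    have h1 : ∀ i, ∑ I', algebraMap F Ω (σ I I') * algebraMap F Ω (v i I') =
        algebraMap F Ω (v i I) := by
      intro i
      conv_rhs => rw [← hv i]
      simp [Matrix.mulVec, dotProduct]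
    simp only [vΩ, Matrix.mulVec, dotProduct, Matrix.map_apply, Finset.mul_sum]
    rw [Finset.sum_comm]
    refine Finset.sum_congr rfl fun i _ => ?_
    rw [← h1 i, Finset.mul_sum]
    exact Finset.sum_congr rfl fun I' _ => by ring
  let f := J.mulVec vΩ
  have hfinv : ∀ (k : Fin p) I, f (fun x => I (x + k)) = f I := by
    intro k I
    have hpow : ∀ m : ℕ, ((σ ^ m).map (algebraMap F Ω)).mulVec vΩ = vΩ := by
      intro m
      induction m with
      | zero => simp [Matrix.map_one]
      | succ m ih => rw [pow_succ, Matrix.map_mul, ← Matrix.mulVec_mulVec, hvΩ, ih]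
    have := shift_pow_mulVec hσ (k : ℕ) vΩ I
    rw [hpow, Fin.ofNat_val_eq_self] at this
    exact this.symm
  have hfconst : ∀ c, f (fun _ => c) = 0 := by
    intro c
    have := congrFun hω c
    simp only [Finset.sum_apply, Pi.smul_apply, smul_eq_mul, diagMap_apply, Pi.zero_apply] at this
    rw [← this]
    simp only [f, vΩ, Matrix.mulVec, dotProduct, Finset.mul_sum]
    rw [Finset.sum_comm]
    exact Finset.sum_congr rfl fun i _ => Finset.sum_congr rfl fun I _ => by ring
  obtain ⟨w, hw0, hw⟩ := Fin.exists_weight p (Fin N) Ω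
  obtain ⟨z, hz⟩ := (Matrix.mulVec_surjective_iff_isUnit.2 hJ) fun I => w I * f I
  have htr : vΩ = ∑ k : Fin p, ((σ ^ (k : ℕ)).map (algebraMap F Ω)).mulVec z := by
    apply Matrix.mulVec_injective_iff_isUnit.2 hJ
    ext I
    rw [Matrix.mulVec_sum, Finset.sum_apply]
    simp only [shift_pow_mulVec hσ, Fin.ofNat_val_eq_self, hz, hfinv]
    rw [← Finset.sum_mul]
    by_cases hI : ∃ c, I = fun _ => c
    · obtain ⟨c, rfl⟩ := hI
      change f _ = _
      rw [hfconst, mul_zero]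
    · rw [hw I hI, one_mul]
  obtain ⟨l, hl⟩ : ∃ l : Ω →ₗ[F] F, l (ω i₀) ≠ 0 := by
    by_contra! hall
    exact hi₀ ((Module.forall_dual_apply_eq_zero_iff F _).1 hall)
  have hlv : ∑ i, l (ω i) • v i = ∑ k : Fin p, (σ ^ (k : ℕ)).mulVec fun I => l (z I) := by
    ext I
    have h1 : l (vΩ I) = ∑ i, l (ω i) * v i I := by
      simp only [vΩ, map_sum]
      refine Finset.sum_congr rfl fun i _ => ?_
      rw [mul_comm, ← Algebra.smul_def, map_smul, smul_eq_mul, mul_comm]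
    have h2 := congrArg l (congrFun htr I)
    rw [h1, Finset.sum_apply, map_sum] at h2
    simp only [Finset.sum_apply, Pi.smul_apply, smul_eq_mul]
    rw [h2]
    refine Finset.sum_congr rfl fun k _ => ?_
    rw [← Matrix.comp_map_algebraMap_mulVec]
  have hzero : diagMap J (∑ i, l (ω i) • v i) = 0 := by
    rw [hlv, map_sum]
    ext c
    have h1 : ∀ k : Fin p, diagMap J ((σ ^ (k : ℕ)).mulVec fun I => l (z I)) c =
        J.mulVec (fun I => algebraMap F Ω (l (z I))) fun _ => c := by
      intro k
      rw [diagMap_apply]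
      refine Eq.trans ?_ (shift_pow_mulVec hσ (k : ℕ) _ fun _ => c)
      congr 2
      ext I
      simp [Matrix.mulVec, dotProduct]
    simp [Finset.sum_apply, h1]
  rw [map_sum] at hzero
  simp only [map_smul] at hzero
  exact hl (Fintype.linearIndependent_iff.1 hind _ hzero i₀)

end ShiftForm

section TensorPower

variable {F A Ω : Type} [Field F] [Ring A] [Algebra F A] [Field Ω] [Algebra F Ω] {p : ℕ}
  {n : Type} [Fintype n] [DecidableEq n]

/-- Products of matrix entries along words, as a multilinear map. -/
noncomputable def tensorPowMultilinear (p : ℕ) (ρ : A →ₐ[F] Matrix n n Ω) :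
    MultilinearMap F (fun _ : Fin p => A) (Matrix (Fin p → n) (Fin p → n) Ω) :=
  MultilinearMap.pi fun I => MultilinearMap.pi fun J =>
    (MultilinearMap.mkPiAlgebra F (Fin p) Ω).compLinearMap fun k =>
      (Matrix.entryLinearMap F Ω (I k) (J k)).comp ρ.toLinearMap

/-- The `p`-th tensor power of a matrix representation, acting on functions on words. -/
noncomputable def tensorPowMatrix (p : ℕ) (ρ : A →ₐ[F] Matrix n n Ω) :
    (⨂[F] _ : Fin p, A) →ₐ[F] Matrix (Fin p → n) (Fin p → n) Ω :=
  PiTensorProduct.liftAlgHom (tensorPowMultilinear p ρ)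
    (by
      ext I J
      change ∏ k, ρ 1 (I k) (J k) = _
      by_cases h : I = J
      · subst h
        simp
      · obtain ⟨k, hk⟩ := Function.ne_iff.1 h
        rw [Matrix.one_apply_ne h]
        exact Finset.prod_eq_zero (Finset.mem_univ k) (by simp [hk]))
    (fun a b => by
      ext I J
      rw [Matrix.mul_apply]
      change ∏ k, ρ (a k * b k) (I k) (J k) =
        ∑ M : Fin p → n, (∏ k, ρ (a k) (I k) (M k)) * ∏ k, ρ (b k) (M k) (J k)
      simp only [map_mul, Matrix.mul_apply, ← Finset.prod_mul_distrib]
      rw [Finset.prod_univ_sum, Fintype.piFinset_univ])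

theorem tensorPowMatrix_tprod (ρ : A →ₐ[F] Matrix n n Ω) (a : Fin p → A) (I J : Fin p → n) :
    tensorPowMatrix p ρ (PiTensorProduct.tprod F a) I J = ∏ k, ρ (a k) (I k) (J k) := by
  simp only [tensorPowMatrix, PiTensorProduct.liftAlgHom, AlgHom.ofLinearMap_apply]
  rw [PiTensorProduct.lift.tprod]
  rfl

/-- Cyclic shift of tensor factors. -/
noncomputable def tensorShift (F A : Type) [Field F] [Ring A] [Algebra F A] (p : ℕ) [NeZero p] :
    (⨂[F] _ : Fin p, A) →ₐ[F] (⨂[F] _ : Fin p, A) :=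
  PiTensorProduct.liftAlgHom
    ((PiTensorProduct.tprod F).domDomCongr (Equiv.addRight (1 : Fin p)))
    rfl
    (fun a b => by
      change PiTensorProduct.tprod F _ = PiTensorProduct.tprod F _ * PiTensorProduct.tprod F _
      rw [PiTensorProduct.tprod_mul_tprod]
      rfl)

theorem tensorShift_tprod [NeZero p] (a : Fin p → A) :
    tensorShift F A p (PiTensorProduct.tprod F a) = PiTensorProduct.tprod F fun k => a (k + 1) := by
  simp only [tensorShift, PiTensorProduct.liftAlgHom, AlgHom.ofLinearMap_apply,
    PiTensorProduct.lift.tprod]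
  rfl

theorem tensorPowMatrix_tensorShift [NeZero p] (ρ : A →ₐ[F] Matrix n n Ω)
    (t : ⨂[F] _ : Fin p, A) (I J : Fin p → n) :
    tensorPowMatrix p ρ (tensorShift F A p t) (fun x => I (x + 1)) (fun x => J (x + 1)) =
      tensorPowMatrix p ρ t I J := by
  induction t using PiTensorProduct.induction_on with
  | smul_tprod c a =>
    simp only [map_smul, Matrix.smul_apply, tensorShift_tprod, tensorPowMatrix_tprod]
    congr 1
    exact Equiv.prod_comp (Equiv.addRight (1 : Fin p)) fun k => ρ (a k) (I k) (J k)
  | add x y hx hy => simp only [map_add, Matrix.add_apply, hx, hy]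

theorem finrank_piTensorProduct_const [FiniteDimensional F A] :
    Module.finrank F (⨂[F] _ : Fin p, A) = Module.finrank F A ^ p := by
  rw [Module.finrank_eq_card_basis
    (Basis.piTensorProduct fun _ : Fin p => Module.finBasis F A)]
  simp

end TensorPower

section ShiftDescent

variable {F A Ω : Type} [Field F] [Ring A] [Algebra F A] [Field Ω] [Algebra F Ω] {p N : ℕ}

/-- Cyclic shift of words. -/
def wordShift (p N : ℕ) [NeZero p] : (Fin p → Fin N) ≃ (Fin p → Fin N) :=
  (Equiv.addRight (1 : Fin p)).symm.arrowCongr (Equiv.refl (Fin N))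

theorem trace_tensorPowMatrix (ρ : A →ₐ[F] Matrix (Fin N) (Fin N) Ω) (a : A) :
    (tensorPowMatrix p ρ (PiTensorProduct.tprod F fun _ => a)).trace = (ρ a).trace ^ p := by
  simp only [Matrix.trace, Matrix.diag, tensorPowMatrix_tprod]
  have := Finset.prod_univ_sum (fun _ : Fin p => Finset.univ) fun _ i => ρ a i i
  rw [Fintype.piFinset_univ] at this
  rw [← this, Fin.prod_const]

theorem sum_tensorPowMatrix_wordShift [Fact p.Prime] [CharP Ω p] (ρ : A →ₐ[F] Matrix (Fin N) (Fin N) Ω) (a : A) :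
    ∑ I, tensorPowMatrix p ρ (PiTensorProduct.tprod F fun _ => a) I ((wordShift p N).symm I) =
      (ρ a).trace ^ p := by
  have hsym : ∀ (I : Fin p → Fin N) k, (wordShift p N).symm I k = I (k - 1) := fun I k => by
    rw [sub_eq_add_neg]; rfl
  simp only [tensorPowMatrix_tprod, hsym]
  rw [Fin.sum_eq_sum_const]
  · simp only [Matrix.trace, Matrix.diag, Finset.prod_const, Finset.card_univ, Fintype.card_fin]
    rw [sum_pow_char]
  · intro I k
    refine Eq.trans ?_ (Equiv.prod_comp (Equiv.addRight k) _)
    refine Finset.prod_congr rfl fun x _ => ?_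
    change ρ a (I (x + k)) (I (x - 1 + k)) = ρ a (I (x + k)) (I (x + k - 1))
    rw [sub_add_eq_add_sub]

theorem Matrix.exists_eq_smul_one_of_commute {ι : Type} [Fintype ι] [DecidableEq ι]
    {X : Matrix ι ι Ω} {s : Set (Matrix ι ι Ω)} (hs : Submodule.span Ω s = ⊤)
    (hX : ∀ M ∈ s, M * X = X * M) : ∃ e : Ω, X = e • 1 := by
  have key : ∀ M, M * X = X * M := by
    intro M
    have hM : M ∈ Submodule.span Ω s := hs ▸ trivial
    induction hM using Submodule.span_induction with
    | mem x hx => exact hX x hx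
    | zero => simp
    | add x y _ _ hx hy => rw [add_mul, mul_add, hx, hy]
    | smul c x _ hx => rw [smul_mul_assoc, hx, mul_smul_comm]
  obtain ⟨e, he⟩ := Matrix.mem_range_scalar_iff_commute_single'.2 fun i j => key (single i j 1)
  exact ⟨e, by rw [← he, Matrix.smul_one_eq_diagonal]; rfl⟩

theorem IsCSA.exists_trace_ne_zero (hA : IsCSA F A) (hN : N * N = Module.finrank F A)
    (ρ : A →ₐ[F] Matrix (Fin N) (Fin N) Ω) : ∃ a, (ρ a).trace ≠ 0 := by
  have hpos := hA.pos_of_sq_eq hN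
  have : Nonempty (Fin N) := ⟨⟨0, hpos⟩⟩
  by_contra! h
  have hz : (Matrix.traceLinearMap (Fin N) Ω Ω) = 0 := by
    apply LinearMap.ext_on (hA.span_range_eq_top ρ (hA.finrank_eq_finrank_matrix Ω hN))
    rintro _ ⟨a, rfl⟩
    exact h a
  have := LinearMap.congr_fun hz (Matrix.single ⟨0, hpos⟩ ⟨0, hpos⟩ 1)
  simp at this

theorem IsCSA.exists_shift_form [Fact p.Prime] [CharP Ω p] (hA : IsCSA F A) (hN : N * N = Module.finrank F A)
    (ρ : A →ₐ[F] Matrix (Fin N) (Fin N) Ω) (hB : IsCSA F (⨂[F] _ : Fin p, A))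
    (θ : (⨂[F] _ : Fin p, A) →ₐ[F] Matrix (Fin p → Fin N) (Fin p → Fin N) F) :
    ∃ (J : Matrix (Fin p → Fin N) (Fin p → Fin N) Ω)
      (σ : Matrix (Fin p → Fin N) (Fin p → Fin N) F), IsUnit J ∧
      (∀ t, tensorPowMatrix p ρ t * J = J * (θ t).map (algebraMap F Ω)) ∧
      (∀ t, θ t * σ = σ * θ (tensorShift F A p t)) ∧
      ∀ v I, J.mulVec ((σ.map (algebraMap F Ω)).mulVec v) I = J.mulVec v fun x => I (x + 1) := by
  have := hA.2.2
  have hpos := hA.pos_of_sq_eq hN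
  have : Nonempty (Fin N) := ⟨⟨0, hpos⟩⟩
  have hcard : Fintype.card (Fin p → Fin N) * Fintype.card (Fin p → Fin N) =
      Module.finrank F (⨂[F] _ : Fin p, A) := by
    rw [finrank_piTensorProduct_const, ← hN]
    simp [mul_pow]
  let τ := tensorPowMatrix p ρ
  let m : Matrix (Fin p → Fin N) (Fin p → Fin N) F →ₐ[F]
    Matrix (Fin p → Fin N) (Fin p → Fin N) Ω := (Algebra.ofId F Ω).mapMatrix
  obtain ⟨J, hJu, hJ⟩ := hB.exists_isUnit_intertwiner hcard (m.comp θ) τ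
  obtain ⟨σ, hσu, hσ⟩ := hB.exists_isUnit_intertwiner hcard (θ.comp (tensorShift F A p)) θ
  replace hJ : ∀ t, τ t * J = J * m (θ t) := hJ
  replace hσ : ∀ t, θ t * σ = σ * θ (tensorShift F A p t) := hσ
  let C : Matrix (Fin p → Fin N) (Fin p → Fin N) Ω := (wordShift p N).toPEquiv.toMatrix
  let C' : Matrix (Fin p → Fin N) (Fin p → Fin N) Ω := (wordShift p N).symm.toPEquiv.toMatrix
  have hCmul : ∀ M, C * M = M.submatrix (wordShift p N) id := fun M =>
    PEquiv.toMatrix_toPEquiv_mul _ _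
  have hmulC : ∀ M, M * C = M.submatrix id (wordShift p N).symm := fun M =>
    PEquiv.mul_toMatrix_toPEquiv _ _
  have hCC' : C * C' = 1 := by
    rw [hCmul]
    ext I K
    simp [C', PEquiv.toMatrix_apply, Matrix.one_apply]
  have hC'C : C' * C = 1 := mul_eq_one_comm.1 hCC'
  have hτC : ∀ t, τ t * C = C * τ (tensorShift F A p t) := by
    intro t
    rw [hCmul, hmulC]
    ext I K
    have := tensorPowMatrix_tensorShift ρ t I ((wordShift p N).symm K)
    refine this.symm.trans ?_
    have h1 : (fun x => (wordShift p N).symm K (x + 1)) = K := (wordShift p N).apply_symm_apply K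
    rw [h1]
    rfl
  obtain ⟨J', hJJ', hJ'J⟩ := isUnit_iff_exists.1 hJu
  let X := J * m σ * J'
  have hτX : ∀ t, τ t * X = X * τ (tensorShift F A p t) := by
    intro t
    have h1 : ∀ t, m (θ t) * J' = J' * τ t := fun t => by
      rw [← one_mul (m (θ t)), ← hJ'J, mul_assoc J', ← hJ, mul_assoc, mul_assoc, hJJ', mul_one]
    calc τ t * X = (τ t * J) * m σ * J' := by simp only [X, mul_assoc]
      _ = J * (m (θ t) * m σ) * J' := by rw [hJ]; simp only [mul_assoc]
      _ = J * m σ * (m (θ (tensorShift F A p t)) * J') := by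
        rw [← map_mul, hσ, map_mul]; simp only [mul_assoc]
      _ = X * τ (tensorShift F A p t) := by rw [h1]; simp only [X, mul_assoc]
  obtain ⟨e, he⟩ := Matrix.exists_eq_smul_one_of_commute (X := X * C')
    (hB.span_range_eq_top τ (by
      have := hB.2.2
      rw [Module.finrank_matrix, ← hcard, Module.finrank_self, mul_one])) (by
      rintro _ ⟨t, rfl⟩
      have h1 : τ (tensorShift F A p t) * C' = C' * τ t := by
        rw [← one_mul (τ (tensorShift F A p t)), ← hC'C, mul_assoc C', ← hτC, mul_assoc, mul_assoc,
          hCC', mul_one]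
      rw [← mul_assoc, hτX, mul_assoc X, h1, ← mul_assoc])
  have hX : X = e • C := by
    rw [← mul_one X, ← hC'C, ← mul_assoc, he, smul_mul_assoc, one_mul]
  obtain ⟨a, ha⟩ := hA.exists_trace_ne_zero hN ρ
  let t := PiTensorProduct.tprod F fun _ : Fin p => a
  have hmtr : ∀ M : Matrix (Fin p → Fin N) (Fin p → Fin N) F,
      (m M).trace = algebraMap F Ω M.trace := fun M => by
    simp [Matrix.trace, m, Algebra.ofId_apply]
  have hT : (ρ a).trace ^ p = algebraMap F Ω (θ t).trace := by
    rw [← trace_tensorPowMatrix, ← hmtr]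
    change (τ t).trace = _
    rw [← mul_one (τ t), ← hJJ', ← mul_assoc, hJ, Matrix.trace_mul_comm, ← mul_assoc, hJ'J, one_mul]
  have heT : e * (ρ a).trace ^ p = algebraMap F Ω (θ t * σ).trace := by
    rw [← sum_tensorPowMatrix_wordShift, ← hmtr, map_mul]
    have h1 : (τ t * X).trace = (m (θ t) * m σ).trace := by
      rw [← mul_assoc, ← mul_assoc, hJ, Matrix.trace_mul_comm, ← mul_assoc, ← mul_assoc, hJ'J,
        one_mul]
    rw [← h1, hX, mul_smul_comm, Matrix.trace_smul, hmulC, smul_eq_mul]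
    rfl
  have he0 : e ≠ 0 := by
    rintro rfl
    rw [zero_smul] at hX
    have hXu : IsUnit X := (hJu.mul (hσu.map m)).mul ⟨⟨J', J, hJ'J, hJJ'⟩, rfl⟩
    exact hXu.ne_zero hX
  obtain ⟨e₀, rfl⟩ : ∃ e₀ : F, algebraMap F Ω e₀ = e := by
    refine ⟨(θ t * σ).trace / (θ t).trace, ?_⟩
    rw [map_div₀, ← hT, ← heT, mul_div_cancel_right₀ _ (pow_ne_zero _ ha)]
  have he₀ : e₀ ≠ 0 := fun h => he0 (by rw [h, map_zero])
  refine ⟨J, e₀⁻¹ • σ, hJu, hJ, fun t => ?_, fun v I => ?_⟩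
  · rw [mul_smul_comm, hσ, smul_mul_assoc]
  · have h1 : J * m (e₀⁻¹ • σ) = C * J := by
      rw [map_smul, mul_smul_comm, ← mul_one (J * m σ), ← hJ'J, ← mul_assoc]
      change e₀⁻¹ • (X * J) = _
      rw [hX, smul_mul_assoc, algebraMap_smul, inv_smul_smul₀ he₀]
    change J.mulVec ((m (e₀⁻¹ • σ)).mulVec v) I = _
    rw [Matrix.mulVec_mulVec, h1, ← Matrix.mulVec_mulVec, PEquiv.toMatrix_toPEquiv_mulVec]
    rfl

end ShiftDescent

section Exponent

variable {F A : Type} [Field F] [Ring A] [Algebra F A]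

theorem isCSA_matrix (F : Type) [Field F] {n : ℕ} (hn : 0 < n) :
    IsCSA F (Matrix (Fin n) (Fin n) F) := by
  have : Nonempty (Fin n) := ⟨⟨0, hn⟩⟩
  exact ⟨inferInstance, inferInstance, inferInstance⟩

theorem map_frobenius_mulVec_of_shift_invariant {Ω : Type} [Field Ω] [Algebra F Ω] {p N : ℕ}
    [Fact p.Prime] [CharP Ω p] (ρ : A →ₐ[F] Matrix (Fin N) (Fin N) Ω) (a : A)
    (f : (Fin p → Fin N) → Ω) (hf : ∀ I k, f (fun x => I (x + k)) = f I) (i : Fin N) :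
    (tensorPowMatrix p ρ (PiTensorProduct.tprod F fun _ => a)).mulVec f (fun _ => i) =
      ((ρ a).map (frobenius Ω p)).mulVec (fun c => f fun _ => c) i := by
  simp only [Matrix.mulVec, dotProduct, tensorPowMatrix_tprod]
  rw [Fin.sum_eq_sum_const]
  · simp [frobenius_def]
  · intro I k
    rw [hf]
    congr 1
    exact Equiv.prod_comp (Equiv.addRight k) fun x => ρ a i (I x)

/-- A central simple algebra whose `p`-th tensor power is split has a split representation with
entries in the field of `p`-th roots. -/
theorem IsCSA.exists_algHom_pow_mem_of_isSplitAlg (hA : IsCSA F A) {p : ℕ} [Fact p.Prime]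
    [CharP F p] (Ω : Type) [Field Ω] [Algebra F Ω] [IsAlgClosed Ω]
    (hsplit : IsSplitAlg F (⨂[F] _ : Fin p, A)) :
    ∃ N, N * N = Module.finrank F A ∧ ∃ ρ : A →ₐ[F] Matrix (Fin N) (Fin N) Ω,
      ∀ a k l, ∃ y : F, algebraMap F Ω y = ρ a k l ^ p := by
  have := hA.2.2
  have : CharP Ω p := charP_of_injective_algebraMap (algebraMap F Ω).injective p
  have : PerfectRing Ω p := inferInstance
  obtain ⟨N, hN, ⟨ρ⟩⟩ := hA.splitsOver_of_isAlgClosed Ω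
  refine ⟨N, hN, ?_⟩
  have hpos := hA.pos_of_sq_eq hN
  obtain ⟨n, hn, ⟨θ⟩⟩ := hsplit
  have hB : IsCSA F (⨂[F] _ : Fin p, A) := (isCSA_matrix F hn).congr θ.symm
  have hcard : n = Fintype.card (Fin p → Fin N) := by
    have h1 := θ.toLinearEquiv.finrank_eq
    rw [finrank_piTensorProduct_const, ← hN, Module.finrank_matrix, Module.finrank_self] at h1
    simp only [Fintype.card_fin, mul_one, mul_pow] at h1
    simp only [Fintype.card_pi, Fintype.card_fin, Finset.prod_const, Finset.card_univ]
    exact (Nat.mul_self_inj.1 h1).symm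
  let θ' : (⨂[F] _ : Fin p, A) →ₐ[F] Matrix (Fin p → Fin N) (Fin p → Fin N) F :=
    (Matrix.reindexAlgEquiv F F (Fintype.equivFinOfCardEq hcard.symm).symm).toAlgHom.comp θ.toAlgHom
  obtain ⟨J, σ, hJu, hJ, hθσ, hσ⟩ := hA.exists_shift_form hN ρ hB θ'
  let S : Submodule F ((Fin p → Fin N) → F) := LinearMap.ker (σ.mulVecLin - LinearMap.id)
  have hS : ∀ v, v ∈ S ↔ σ.mulVec v = v := fun v => by simp [S, sub_eq_zero]
  refine hA.exists_algHom_pow_mem (p := p) hN ρ (S.map (diagMap J)) ?_ ?_ ?_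
  · obtain ⟨v, hv, hv0⟩ := exists_diagMap_ne_zero hpos hJu hσ
    exact fun h => hv0 ((Submodule.eq_bot_iff _).1 h _ ⟨v, (hS v).2 hv, rfl⟩)
  · rintro a _ ⟨v, hv, rfl⟩
    replace hv := (hS v).1 hv
    let t := PiTensorProduct.tprod F fun _ : Fin p => a
    have hst : tensorShift F A p t = t := tensorShift_tprod _
    have hmap : ∀ (M : Matrix (Fin p → Fin N) (Fin p → Fin N) F) (v : (Fin p → Fin N) → F),
        (fun I => algebraMap F Ω (M.mulVec v I)) =
          (M.map (algebraMap F Ω)).mulVec fun I => algebraMap F Ω (v I) := fun M v => by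
      ext I
      simp [Matrix.mulVec, dotProduct]
    refine ⟨(θ' t).mulVec v, (hS _).2 ?_, ?_⟩
    · rw [Matrix.mulVec_mulVec, ← hst, ← hθσ, hst, ← Matrix.mulVec_mulVec, hv]
    · let f := J.mulVec fun I => algebraMap F Ω (v I)
      have hf : ∀ I (k : Fin p), f (fun x => I (x + k)) = f I := by
        intro I k
        have hpow : ∀ m : ℕ, (σ ^ m).mulVec v = v := by
          intro m
          induction m with
          | zero => simp
          | succ m ih => rw [pow_succ, ← Matrix.mulVec_mulVec, hv, ih]
        have := shift_pow_mulVec hσ (k : ℕ) (fun I => algebraMap F Ω (v I)) I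
        rw [← hmap, hpow, Fin.ofNat_val_eq_self] at this
        exact this.symm
      ext i
      rw [diagMap_apply, hmap, Matrix.mulVec_mulVec, ← hJ, ← Matrix.mulVec_mulVec]
      exact map_frobenius_mulVec_of_shift_invariant ρ a f hf i
  · intro h u hu
    choose v hv hvu using fun i => (u i).2
    refine le_of_linearIndependent_diagMap hJu hσ v (fun i => (hS _).1 (hv i)) ?_
    simp only [hvu]
    exact hu.map' (Submodule.subtype _) (Submodule.ker_subtype _)

end Exponent

section CyclicSplitting

variable {p : ℕ} {M C : Type} [Field M] [Ring C] [Algebra M C]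

theorem SymbolRel.exists_mul_eq_smul [Fact p.Prime] [CharP M p] [Nontrivial C] {a b y : M}
    {i j : C} (h : SymbolRel p a b i j) (hy : y ^ p = b) :
    ∃ z : C, z ≠ 0 ∧ j * z = y • z := by
  have hp : p.Prime := Fact.out
  have : CharP C p := charP_of_injective_algebraMap (algebraMap M C).injective p
  have hcomm : Commute j (algebraMap M C y) := Algebra.commute_algebraMap_right y j
  have hnil : (j - algebraMap M C y) ^ p = 0 := by
    rw [sub_pow_char_of_commute p hcomm, h.pow_eq, ← map_pow, hy, sub_self]
  obtain ⟨n, hn, hmin⟩ : ∃ n, (j - algebraMap M C y) ^ n ≠ 0 ∧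
      (j - algebraMap M C y) ^ (n + 1) = 0 := by
    by_contra! hcon
    have : ∀ n, (j - algebraMap M C y) ^ n ≠ 0 := fun n => by
      induction n with
      | zero => simp
      | succ n ih => exact hcon n ih
    exact this p hnil
  refine ⟨_, hn, ?_⟩
  rw [pow_succ', sub_mul, sub_eq_zero] at hmin
  rw [hmin, Algebra.smul_def]

theorem IsCyclicAlgWith.splitsOver [Fact p.Prime] [CharP M p] {a b : M}
    (h : IsCyclicAlgWith p M C a b) {P : Type} [Field P] [Algebra M P] (y : P)
    (hy : y ^ p = algebraMap M P b) : SplitsOver M C P := by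
  have hp : p.Prime := Fact.out
  have hC : IsCSA M C := IsCyclicPAlg.isCSA ⟨a, b, h⟩
  obtain ⟨hb, hrank, i, j, hi, hj, hij, htop⟩ := h
  have hrel : SymbolRel p a b i j := ⟨hb, hi, hj, hij⟩
  have := hC.isSimpleRing_baseChange P
  have : CharP P p := charP_of_injective_algebraMap (algebraMap M P).injective p
  have := hC.2.2
  let ι : C →ₐ[M] P ⊗[M] C := Algebra.TensorProduct.includeRight
  have hrel' : SymbolRel p (algebraMap M P a) (algebraMap M P b) (ι i) (ι j) :=
    (hrel.map ι).extendScalars P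
  obtain ⟨z, hz, hjz⟩ := hrel'.exists_mul_eq_smul hy
  let V : Submodule (P ⊗[M] C) (P ⊗[M] C) := Submodule.span _ {z}
  have hzV : z ∈ V := Submodule.mem_span_singleton_self z
  have : Nontrivial V := ⟨⟨⟨z, hzV⟩, 0, fun h0 => hz (congrArg Subtype.val h0)⟩⟩
  have : FiniteDimensional P V :=
    inferInstanceAs (FiniteDimensional P (V.restrictScalars P))
  have hpow : ∀ t : ℕ, ι j ^ t * z = y ^ t • z := fun t => by
    induction t with
    | zero => simp
    | succ t ih => rw [pow_succ, mul_assoc, hjz, mul_smul_comm, ih, smul_smul, pow_succ']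
  have hle : V.restrictScalars P ≤
      Submodule.span P (Set.range fun s : Fin p => ι i ^ (s : ℕ) * z) := by
    intro v hv
    obtain ⟨c, rfl⟩ := Submodule.mem_span_singleton.1 hv
    rw [smul_eq_mul]
    induction c using TensorProduct.induction_on with
    | zero => simp
    | add c d hc hd =>
      rw [add_mul]
      exact add_mem (hc (Submodule.smul_mem _ _ hzV)) (hd (Submodule.smul_mem _ _ hzV))
    | tmul x c =>
      have hc : c ∈ Submodule.span M
          (Set.range fun u : Fin p × Fin p => i ^ (u.2 : ℕ) * j ^ (u.1 : ℕ)) :=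
        hrel.span_eq_top hp.one_lt htop ▸ trivial
      have hx : (x ⊗ₜ[M] c : P ⊗[M] C) = x • ι c := by
        simp [ι, TensorProduct.smul_tmul']
      rw [hx, smul_mul_assoc]
      refine Submodule.smul_mem _ _ ?_
      clear hx hv
      induction hc using Submodule.span_induction with
      | mem c hc =>
        obtain ⟨u, rfl⟩ := hc
        simp only [map_mul, map_pow]
        rw [mul_assoc, hpow, mul_smul_comm]
        exact Submodule.smul_mem _ _ (Submodule.subset_span ⟨u.2, rfl⟩)
      | zero => simp
      | add c d _ _ hc hd => rw [map_add, add_mul]; exact add_mem hc hd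
      | smul r c _ hc =>
        rw [map_smul, smul_mul_assoc, ← algebraMap_smul P r]
        exact Submodule.smul_mem _ _ hc
  have hdim : Module.finrank P V ≤ p := by
    have h1 := Submodule.finrank_mono hle
    have h2 := finrank_range_le_card (R := P) fun s : Fin p => ι i ^ (s : ℕ) * z
    rw [Fintype.card_fin] at h2
    exact h1.trans h2
  exact hC.splitsOver_of_end (V := V)
    (((Algebra.lsmul P P V).restrictScalars M).comp ι) (by rw [hrank, sq]) hdim

end CyclicSplitting

section MatrixRepresentation

theorem AlgHom.exists_end_of_matrix {M B P V : Type} [Field M] [Ring B] [Algebra M B] [Field P]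
    [Algebra M P] [AddCommGroup V] [Module P V] [Module M V] [IsScalarTower M P V]
    [FiniteDimensional P V] [Nontrivial V] [IsSimpleRing B] {n : ℕ} (hn : 0 < n)
    (f : Matrix (Fin n) (Fin n) B →ₐ[M] Module.End P V) :
    ∃ W : Submodule P V, n * Module.finrank P W ≤ Module.finrank P V ∧ Nontrivial W ∧
      Nonempty (B →ₐ[M] Module.End P W) := by
  have : NeZero n := ⟨hn.ne'⟩
  have hmul : ∀ (i j k : Fin n) (b c : B) (v : V), f (.single i j b) (f (.single j k c) v) =
      f (.single i k (b * c)) v := fun i j k b c v => by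
    rw [← Module.End.mul_apply, ← map_mul, Matrix.single_mul_single_same]
  let W : Submodule P V := LinearMap.range (f (.single 0 0 1))
  have hW : ∀ (b : B) (v : V), f (.single 0 0 b) v ∈ W := fun b v =>
    ⟨f (.single 0 0 b) v, by rw [hmul, one_mul]⟩
  have hid : ∀ w ∈ W, f (.single 0 0 1) w = w := by
    rintro _ ⟨v, rfl⟩
    rw [hmul, one_mul]
  let g : B →ₐ[M] Module.End P W :=
    { toFun := fun b => (f (.single 0 0 b)).restrict fun v _ => hW b v
      map_one' := by
        ext w
        exact hid w w.2
      map_mul' := fun b c => by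
        ext w
        exact (hmul 0 0 0 b c w).symm
      map_zero' := by
        ext w
        change f (.single 0 0 0) (w : V) = 0
        rw [Matrix.single_zero, map_zero, LinearMap.zero_apply]
      map_add' := fun b c => by
        ext w
        change f (.single 0 0 (b + c)) (w : V) = f (.single 0 0 b) (w : V) + f (.single 0 0 c) w
        rw [Matrix.single_add, map_add, LinearMap.add_apply]
      commutes' := fun r => by
        ext w
        change f (.single 0 0 (algebraMap M B r)) (w : V) = r • (w : V)
        rw [Algebra.algebraMap_eq_smul_one, ← Matrix.smul_single, map_smul, LinearMap.smul_apply,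
          hid w w.2] }
  refine ⟨W, ?_, ?_, ⟨g⟩⟩
  · let φ : (Fin n → W) →ₗ[P] V :=
      LinearMap.lsum P (fun _ => W) P fun i => (f (.single i 0 1)) ∘ₗ W.subtype
    have hφ : Function.Injective φ := by
      rw [← LinearMap.ker_eq_bot, LinearMap.ker_eq_bot']
      intro w hw
      funext k
      have h1 := congrArg (f (.single 0 k 1)) hw
      simp only [φ, LinearMap.lsum_apply, LinearMap.sum_apply, map_sum, map_zero,
        LinearMap.comp_apply, LinearMap.proj_apply, Submodule.subtype_apply] at h1
      rw [Finset.sum_eq_single k] at h1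
      · rw [hmul, one_mul, hid _ (w k).2] at h1
        exact Subtype.ext h1
      · intro i _ hik
        rw [← Module.End.mul_apply, ← map_mul, Matrix.single_mul_single_of_ne _ _ _ _ hik.symm,
          map_zero, LinearMap.zero_apply]
      · simp
    have h2 := LinearMap.finrank_le_finrank_of_injective hφ
    rwa [Module.finrank_pi_fintype, Finset.sum_const, Finset.card_univ, Fintype.card_fin,
      smul_eq_mul] at h2
  · rw [Submodule.nontrivial_iff_ne_bot]
    intro h0
    have h1 : f (.single 0 0 1) = 0 := LinearMap.range_eq_bot.1 h0
    have h2 : (Matrix.single 0 0 1 : Matrix (Fin n) (Fin n) B) = 0 :=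
      f.toRingHom.injective (h1.trans (map_zero f).symm)
    have h3 := congrFun (congrFun h2 0) 0
    rw [Matrix.single_apply_same] at h3
    exact one_ne_zero h3

theorem IsCSA.splitsOver_of_isBrauerEquiv {M B C P : Type} [Field M] [Ring B] [Algebra M B]
    [Ring C] [Algebra M C] [Field P] [Algebra M P] (hB : IsCSA M B) (hC : IsCSA M C)
    (h : IsBrauerEquiv M B C) (hs : SplitsOver M C P) : SplitsOver M B P := by
  obtain ⟨n, m, hn, hm, ⟨e⟩⟩ := h
  obtain ⟨r, hr, ⟨ρ⟩⟩ := hs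
  obtain ⟨N, hN, -⟩ := hB.splitsOver_of_isAlgClosed (AlgebraicClosure M)
  have hr0 := hC.pos_of_sq_eq hr
  have : NeZero m := ⟨hm.ne'⟩
  have : NeZero r := ⟨hr0.ne'⟩
  have := hB.2.1
  have hdim : n * N = m * r := by
    have := e.toLinearEquiv.finrank_eq
    simp only [Module.finrank_matrix, Fintype.card_fin] at this
    rw [← hN, ← hr] at this
    refine Nat.mul_self_inj.1 ?_
    linarith
  let f : Matrix (Fin n) (Fin n) B →ₐ[M] Module.End P (Fin m × Fin r → P) :=
    (AlgEquiv.toAlgHom (((Matrix.toLinAlgEquiv' (R := P)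
        (n := Fin m × Fin r)).restrictScalars M))).comp
      ((AlgEquiv.toAlgHom (Matrix.compAlgEquiv (Fin m) (Fin r) P M)).comp
        (ρ.mapMatrix.comp e.toAlgHom))
  obtain ⟨W, hW, _, ⟨g⟩⟩ := f.exists_end_of_matrix hn
  refine hB.splitsOver_of_end g hN ?_
  rw [Module.finrank_fintype_fun_eq_card, Fintype.card_prod, Fintype.card_fin, Fintype.card_fin,
    ← hdim] at hW
  exact Nat.le_of_mul_le_mul_left hW hn

end MatrixRepresentation

section IndexUniqueness

variable {F D D' : Type} [Field F] [DivisionRing D] [Algebra F D] [DivisionRing D'] [Algebra F D']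

theorem mul_finrank_le_of_matrix_algHom [FiniteDimensional F D'] {m m' : ℕ} (hm : 0 < m)
    (hm' : 0 < m') (e : Matrix (Fin m) (Fin m) D →ₐ[F] Matrix (Fin m') (Fin m') D') :
    m * Module.finrank F D ≤ m' * Module.finrank F D' := by
  have : NeZero m' := ⟨hm'.ne'⟩
  let act : D' →ₐ[F] Module.End F D' := Algebra.lmul F D'
  let b := Module.finBasis F D'
  let f : Matrix (Fin m) (Fin m) D →ₐ[F]
      Module.End F (Fin m' × Fin (Module.finrank F D') → F) :=
    (AlgEquiv.toAlgHom (Matrix.toLinAlgEquiv' (R := F))).comp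
      ((AlgEquiv.toAlgHom (Matrix.compAlgEquiv (Fin m') (Fin (Module.finrank F D')) F F)).comp
        (((algEquivMatrix b).toAlgHom.comp act).mapMatrix.comp e))
  have : NeZero (Module.finrank F D') := ⟨Module.finrank_pos.ne'⟩
  obtain ⟨W, hW, hne, ⟨g⟩⟩ := f.exists_end_of_matrix hm
  obtain ⟨w, hw⟩ := exists_ne (0 : W)
  have hinj : Function.Injective ((LinearMap.applyₗ w).comp g.toLinearMap : D →ₗ[F] W) := by
    rw [← LinearMap.ker_eq_bot, LinearMap.ker_eq_bot']
    intro d hd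
    by_contra h0
    have h1 : g d⁻¹ (g d w) = 0 := by
      rw [show g d w = 0 from hd, map_zero]
    rw [← Module.End.mul_apply, ← map_mul, inv_mul_cancel₀ h0, map_one] at h1
    exact hw h1
  have h2 := LinearMap.finrank_le_finrank_of_injective hinj
  rw [Module.finrank_fintype_fun_eq_card, Fintype.card_prod, Fintype.card_fin,
    Fintype.card_fin] at hW
  exact (Nat.mul_le_mul_left m h2).trans hW

theorem finrank_eq_of_matrix_algEquiv [FiniteDimensional F D] [FiniteDimensional F D'] {m m' : ℕ}
    (hm : 0 < m) (hm' : 0 < m')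
    (e : Matrix (Fin m) (Fin m) D ≃ₐ[F] Matrix (Fin m') (Fin m') D') :
    Module.finrank F D = Module.finrank F D' := by
  have h1 := (mul_finrank_le_of_matrix_algHom hm hm' e.toAlgHom).antisymm
    (mul_finrank_le_of_matrix_algHom hm' hm e.symm.toAlgHom)
  have h2 := e.toLinearEquiv.finrank_eq
  simp only [Module.finrank_matrix, Fintype.card_fin] at h2
  have hD : 0 < Module.finrank F D := Module.finrank_pos
  have h3 : m = m' := by
    rw [mul_assoc, mul_assoc, ← h1] at h2
    exact Nat.eq_of_mul_eq_mul_right (Nat.mul_pos hm hD) h2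
  subst h3
  exact Nat.eq_of_mul_eq_mul_left hm h1

theorem HasIndex.unique {A B : Type} [Ring A] [Algebra F A] [Ring B] [Algebra F B]
    {d d' : ℕ} (hd : 0 < d) (hd' : 0 < d') (h : HasIndex F A d) (h' : HasIndex F B d')
    (e : A ≃ₐ[F] B) : d = d' := by
  obtain ⟨D, _, _, m, hm, ⟨f⟩, hD⟩ := h
  obtain ⟨D', _, _, m', hm', ⟨f'⟩, hD'⟩ := h'
  have : FiniteDimensional F D := Module.finite_of_finrank_pos (hD ▸ pow_pos hd 2)
  have : FiniteDimensional F D' := Module.finite_of_finrank_pos (hD' ▸ pow_pos hd' 2)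
  have := finrank_eq_of_matrix_algEquiv hm hm' (f.symm.trans (e.trans f'))
  rw [hD, hD'] at this
  exact Nat.pow_left_injective (n := 2) (by norm_num) this

end IndexUniqueness

section SeparableSplitting

theorem exists_sum_mul_pow_eq {p : ℕ} [Fact p.Prime] {F M Ω : Type} [Field F] [Field M] [Field Ω]
    [Algebra F M] [Algebra M Ω] [Algebra F Ω] [IsScalarTower F M Ω] [CharP F p] [IsAlgClosed Ω]
    [FiniteDimensional F M] [Algebra.IsSeparable F M] (b : M) :
    ∃ (g : Fin (Module.finrank F M) → Ω) (x : Fin (Module.finrank F M) → M),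
      (∀ i, ∃ y : F, algebraMap F Ω y = g i ^ p) ∧
      (∑ i, g i * algebraMap M Ω (x i)) ^ p = algebraMap M Ω b := by
  have hp : p.Prime := Fact.out
  have : ExpChar F p := .prime hp
  have : CharP Ω p := charP_of_injective_algebraMap (algebraMap F Ω).injective p
  have : ExpChar Ω p := .prime hp
  let x := Module.finBasis F M
  have hspan := Field.span_map_pow_expChar_pow_eq_top_of_isSeparable p 1 x.span_eq
  have hb : b ∈ Submodule.span F (Set.range (x · ^ p ^ 1)) := hspan ▸ trivial
  obtain ⟨c, hc⟩ := (Submodule.mem_span_range_iff_exists_fun F).1 hb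
  choose g hg using fun i => IsAlgClosed.exists_pow_nat_eq (algebraMap F Ω (c i)) hp.pos
  refine ⟨g, x, fun i => ⟨c i, (hg i).symm⟩, ?_⟩
  rw [sum_pow_char p, ← hc, map_sum]
  refine Finset.sum_congr rfl fun i _ => ?_
  rw [mul_pow, hg, pow_one, Algebra.smul_def, map_mul, map_pow, ← IsScalarTower.algebraMap_apply]

theorem IsCSA.baseChange {F A : Type} [Field F] [Ring A] [Algebra F A] (hA : IsCSA F A)
    (M : Type) [Field M] [Algebra F M] : IsCSA M (M ⊗[F] A) := by
  have := hA.1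
  have := hA.2.2
  refine ⟨⟨fun z hz => ?_⟩, hA.isSimpleRing_baseChange M, inferInstance⟩
  have hz' : z ∈ Subalgebra.centralizer F
      (Algebra.TensorProduct.includeRight : A →ₐ[F] M ⊗[F] A).range := by
    rw [Subalgebra.mem_centralizer_iff]
    exact fun t _ => Subalgebra.mem_center_iff.1 hz t
  rw [Subalgebra.centralizer_range_includeRight_eq_center_tensorProduct,
    Algebra.IsCentral.center_eq_bot] at hz'
  obtain ⟨t, rfl⟩ := hz'
  clear hz
  induction t using TensorProduct.induction_on with
  | zero => simp
  | add t u ht hu =>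
    rw [map_add]
    exact add_mem ht hu
  | tmul x c =>
    obtain ⟨_, r, rfl⟩ := c
    refine ⟨r • x, ?_⟩
    change (r • x) ⊗ₜ[F] (1 : A) = x ⊗ₜ[F] algebraMap F A r
    rw [TensorProduct.smul_tmul, Algebra.algebraMap_eq_smul_one]

theorem IsCSA.splitsOver_of_baseChange {F A M P : Type} [Field F] [Ring A] [Algebra F A]
    [Field M] [Algebra F M] [Field P] [Algebra F P] [Algebra M P] [IsScalarTower F M P]
    (h : SplitsOver M (M ⊗[F] A) P) : SplitsOver F A P := by
  obtain ⟨N, hN, ⟨ρ⟩⟩ := h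
  rw [Module.finrank_baseChange] at hN
  exact ⟨N, hN, ⟨(ρ.restrictScalars F).comp Algebra.TensorProduct.includeRight⟩⟩

theorem IsCSA.exists_algHom_matrix_of_isBrauerEquiv {p : ℕ} [Fact p.Prime] {F A M Ω C : Type}
    [Field F] [Ring A] [Algebra F A] [Field M] [Field Ω] [Algebra F M] [Algebra M Ω]
    [Algebra F Ω] [IsScalarTower F M Ω] [CharP F p] [FiniteDimensional F M]
    [Ring C] [Algebra M C] (hA : IsCSA F A) {a b : M}
    (hC : IsCyclicAlgWith p M C a b) (hAC : IsBrauerEquiv M (M ⊗[F] A) C)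
    (K : IntermediateField F Ω) {r : ℕ} (g : Fin r → Ω) (x : Fin r → M) (hg : ∀ i, g i ∈ K)
    (hy : (∑ i, g i * algebraMap M Ω (x i)) ^ p = algebraMap M Ω b) :
    ∃ N R : ℕ, N * N = Module.finrank F A ∧ 0 < R ∧ R ≤ Module.finrank F M * N ∧
      Nonempty (A →ₐ[F] Matrix (Fin R) (Fin R) K) := by
  have : CharP M p := charP_of_injective_algebraMap (algebraMap F M).injective p
  let ι : M →ₐ[F] Ω := IsScalarTower.toAlgHom F M Ω
  have : FiniteDimensional F ι.fieldRange :=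
    inferInstanceAs (FiniteDimensional F (LinearMap.range ι.toLinearMap))
  have hrank : Module.finrank F ι.fieldRange = Module.finrank F M :=
    LinearMap.finrank_range_of_inj (f := ι.toLinearMap) ι.toRingHom.injective
  let P : IntermediateField K Ω := IntermediateField.adjoin K (ι.fieldRange : Set Ω)
  have hP : ∀ m : M, algebraMap M Ω m ∈ P := fun m =>
    IntermediateField.subset_adjoin K _ ⟨m, rfl⟩
  have hle := IntermediateField.adjoin_rank_le_of_isAlgebraic_right K ι.fieldRange
  have : FiniteDimensional K P :=
    Module.rank_lt_aleph0_iff.1 (hle.trans_lt (Module.rank_lt_aleph0 _ _))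
  have hPd : Module.finrank K P ≤ Module.finrank F M := by
    rw [← hrank]
    exact Cardinal.toNat_le_toNat hle (Module.rank_lt_aleph0 _ _)
  let : Algebra M P := (RingHom.codRestrict (algebraMap M Ω) P hP).toAlgebra
  have : IsScalarTower F M P := .of_algebraMap_eq fun t =>
    Subtype.ext (IsScalarTower.algebraMap_apply F M Ω t)
  have hyP : ∑ i, g i * algebraMap M Ω (x i) ∈ P :=
    sum_mem fun i _ => mul_mem (algebraMap_mem P ⟨g i, hg i⟩) (hP _)
  have hsC : SplitsOver M C P := hC.splitsOver (P := P) ⟨_, hyP⟩ (Subtype.ext hy)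
  obtain ⟨N, hN, ⟨ρ⟩⟩ := IsCSA.splitsOver_of_baseChange
    ((hA.baseChange M).splitsOver_of_isBrauerEquiv (IsCyclicPAlg.isCSA ⟨a, b, hC⟩) hAC hsC)
  have : Module.Free K P := .of_divisionRing K P
  let B := Module.finBasis K P
  let e : Fin N × Fin (Module.finrank K P) ≃ Fin (N * Module.finrank K P) := finProdFinEquiv
  let τ : P →ₐ[F] Matrix (Fin (Module.finrank K P)) (Fin (Module.finrank K P)) K :=
    ((algEquivMatrix B).toAlgHom.comp (Algebra.lmul K P)).restrictScalars F
  refine ⟨N, N * Module.finrank K P, hN, Nat.mul_pos (hA.pos_of_sq_eq hN) Module.finrank_pos,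
    (Nat.mul_le_mul_left N hPd).trans_eq (mul_comm _ _), ⟨?_⟩⟩
  exact (AlgEquiv.toAlgHom (Matrix.reindexAlgEquiv F K e)).comp
    ((AlgEquiv.toAlgHom (Matrix.compAlgEquiv (Fin N) (Fin (Module.finrank K P)) K F)).comp
      (τ.mapMatrix.comp ρ))

end SeparableSplitting

section SymbolLength

theorem IntermediateField.adjoin_range_append_eq_top {F K E : Type} [Field F] [Field K] [Field E]
    [Algebra F K] [Algebra K E] [Algebra F E] [IsScalarTower F K E] {r s : ℕ} {g : Fin r → K}
    {h : Fin s → E} (hg : IntermediateField.adjoin F (Set.range g) = ⊤)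
    (hh : IntermediateField.adjoin K (Set.range h) = ⊤) :
    IntermediateField.adjoin F (Set.range (Fin.append (fun i => algebraMap K E (g i)) h)) = ⊤ := by
  set L := IntermediateField.adjoin F (Set.range (Fin.append (fun i => algebraMap K E (g i)) h))
  have hK : ∀ x : K, algebraMap K E x ∈ L := by
    intro x
    have hx : x ∈ IntermediateField.adjoin F (Set.range g) := hg ▸ trivial
    have hmap := IntermediateField.adjoin_map F (Set.range g) (IsScalarTower.toAlgHom F K E)
    have hle : IntermediateField.adjoin F (IsScalarTower.toAlgHom F K E '' Set.range g) ≤ L := by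
      refine IntermediateField.adjoin_le_iff.2 ?_
      rintro _ ⟨_, ⟨i, rfl⟩, rfl⟩
      exact IntermediateField.subset_adjoin F _ ⟨Fin.castAdd s i, Fin.append_left _ _ i⟩
    exact hle (hmap ▸ ⟨x, hx, rfl⟩)
  refine eq_top_iff.2 fun x _ => ?_
  have hx : x ∈ IntermediateField.adjoin K (Set.range h) := hh ▸ trivial
  clear hh
  induction hx using IntermediateField.adjoin_induction with
  | mem x hx =>
    obtain ⟨i, rfl⟩ := hx
    exact IntermediateField.subset_adjoin F _ ⟨Fin.natAdd r i, Fin.append_right _ _ i⟩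
  | algebraMap x => exact hK x
  | add x y _ _ hx hy => exact add_mem (hx trivial) (hy trivial)
  | inv x _ hx => exact inv_mem (hx trivial)
  | mul x y _ _ hx hy => exact mul_mem (hx trivial) (hy trivial)

theorem IsCSA.symbolLengthLE_of_isBrauerEquiv {p : ℕ} [Fact p.Prime] {F A M C : Type}
    [Field F] [Ring A] [Algebra F A] [Field M] [Algebra F M] [CharP F p] [FiniteDimensional F M]
    [Algebra.IsSeparable F M] [Ring C] [Algebra M C] (hA : IsCSA F A)
    (hsplit : IsSplitAlg F (⨂[F] _ : Fin p, A)) (hC : IsCyclicPAlg p M C)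
    (hAC : IsBrauerEquiv M (M ⊗[F] A) C) :
    SymbolLengthLE p F A (2 * Module.finrank F M - 1) := by
  obtain ⟨a, b, hC⟩ := hC
  have := hA.2.2
  let Ω := AlgebraicClosure M
  obtain ⟨g, x, hg, hy⟩ := exists_sum_mul_pow_eq (p := p) (F := F) (Ω := Ω) b
  let K : IntermediateField F Ω := IntermediateField.adjoin F (Set.range g)
  have hgK : ∀ i, g i ∈ K := fun i => IntermediateField.subset_adjoin F _ ⟨i, rfl⟩
  have hKtop : IntermediateField.adjoin F (Set.range fun i => (⟨g i, hgK i⟩ : K)) = ⊤ := by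
    refine IntermediateField.map_injective K.val ?_
    rw [IntermediateField.adjoin_map, ← Set.range_comp, ← AlgHom.fieldRange_eq_map,
      IntermediateField.fieldRange_val]
    rfl
  obtain ⟨N, R, hN, hR, hRm, ⟨τ⟩⟩ :=
    hA.exists_algHom_matrix_of_isBrauerEquiv hC hAC K g x hgK hy
  obtain ⟨N', hN', ρ, hρ⟩ := hA.exists_algHom_pow_mem_of_isSplitAlg (p := p) Ω hsplit
  let S : Set Ω := Set.range fun u : Fin (Module.finrank F A) × Fin N' × Fin N' =>
    ρ (Module.finBasis F A u.1) u.2.1 u.2.2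
  let κ : IntermediateField K Ω := IntermediateField.adjoin K S
  have hκ : ∀ x : κ, ∃ y : F, algebraMap F κ y = x ^ p := by
    intro x
    have hx : (x : Ω) ∈ IntermediateField.adjoin F (Set.range g ∪ S) := by
      rw [← IntermediateField.adjoin_adjoin_left]
      exact x.2
    obtain ⟨y, hy⟩ := IntermediateField.exists_algebraMap_eq_pow_of_mem_adjoin (p := p) (by
      rintro _ (⟨i, rfl⟩ | ⟨u, rfl⟩)
      · exact hg i
      · exact hρ _ _ _) hx
    exact ⟨y, Subtype.ext hy⟩
  have : FiniteDimensional K κ := by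
    have : Finite S := Set.finite_range _
    refine IntermediateField.finiteDimensional_adjoin fun z hz => ?_
    obtain ⟨u, rfl⟩ := hz
    obtain ⟨y, hy⟩ := hρ (Module.finBasis F A u.1) u.2.1 u.2.2
    have : IsIntegral F (ρ (Module.finBasis F A u.1) u.2.1 u.2.2) :=
      .of_pow (Fact.out : p.Prime).pos (hy ▸ isIntegral_algebraMap)
    exact this.tower_top
  have hs : SplitsOver F A κ := by
    refine ⟨N', hN', AlgHom.exists_matrix_descent (κ.val.restrictScalars F) ρ fun a k l => ?_⟩
    refine ⟨⟨ρ a k l, ?_⟩, rfl⟩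
    rw [← (Module.finBasis F A).sum_repr a, map_sum, Matrix.sum_apply]
    refine sum_mem fun i _ => ?_
    rw [map_smul, Matrix.smul_apply, Algebra.smul_def, IsScalarTower.algebraMap_apply F K Ω]
    exact mul_mem (algebraMap_mem κ _) (IntermediateField.subset_adjoin K _ ⟨(i, k, l), rfl⟩)
  have hd : 0 < Module.finrank F M := Module.finrank_pos
  obtain ⟨E, hE, h, hh⟩ := hA.exists_splitsOver_adjoin_eq_top hκ hd hR hN hRm τ hs
  have htop := IntermediateField.adjoin_range_append_eq_top hKtop hh
  have := hA.symbolLengthLE_of_splitsOver (p := p) _ hE _ (fun i => ?_) htop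
  · convert this using 1
    lia
  · obtain ⟨y, hy⟩ := hκ (Fin.append (fun i => algebraMap K E ⟨g i, hgK i⟩) h i : E)
    exact ⟨y, Subtype.ext hy⟩

end SymbolLength

theorem IsCompositum.surjective_algebraMap {F L K M : Type} [Field F] [Field L] [Field K]
    [Field M] [Algebra F L] [Algebra F K] [Algebra F M] [Algebra L M] [Algebra K M]
    [IsScalarTower F L M] [IsScalarTower F K M] (h : IsCompositum F L K M)
    (hK : Function.Surjective (algebraMap F K)) : Function.Surjective (algebraMap L M) := by
  have hbot : (IsScalarTower.toAlgHom F K M).range = ⊥ := by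
    refine eq_bot_iff.2 ?_
    rintro _ ⟨x, rfl⟩
    obtain ⟨x, rfl⟩ := hK x
    exact ⟨x, IsScalarTower.algebraMap_apply F K M x⟩
  rw [IsCompositum, hbot, sup_bot_eq] at h
  exact (AlgHom.range_eq_top _).1 h

/-- Over a `p`-cyclic reducible field `F` of characteristic `p`, a central
simple algebra of exponent `p` and index `p ^ n` has `p`-symbol length at most
`2 * p ^ (n - 1) - 1`. -/
theorem statement8 (p : ℕ) (hp : p.Prime) (F : Type) [Field F] [CharP F p]
    (hred : IsPCyclicReducible p F) (A : Type) [Ring A] [Algebra F A] (hA : IsCSA F A)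
    (hexp : HasExponent F A p) (n : ℕ) (hn : 0 < n) (hind : HasIndex F A (p ^ n)) :
    SymbolLengthLE p F A (2 * p ^ (n - 1) - 1) := by
  have : Fact p.Prime := ⟨hp⟩
  rcases hred A hA hexp F inferInstance (fun z => ⟨z ^ p, rfl⟩) with
    ⟨r, hr, ⟨e⟩⟩ | ⟨d, hd, L, _, _, hsep, hLd, M, _, algM, _, algM', _, tower, hcomp,
        C, _, _, hC, hAC⟩
  · exact SymbolLengthLE.of_isSplitAlg
      ⟨r, hr, ⟨(Algebra.TensorProduct.lid F A).symm.trans e⟩⟩ _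
  have hpos : 0 < p ^ n := pow_pos hp.pos n
  have hd0 : 0 < p * d := by
    refine Nat.pos_of_ne_zero fun h0 => ?_
    obtain ⟨D, _, _, m, hm, ⟨e⟩, hD⟩ := hd
    have := (hA.baseChange F).finrank_pos
    rw [e.toLinearEquiv.finrank_eq, Module.finrank_matrix, hD, h0] at this
    simp at this
  have hdeg : p ^ n = p * d :=
    HasIndex.unique hpos hd0 hind hd (Algebra.TensorProduct.lid F A).symm
  have hd' : d = p ^ (n - 1) := by
    obtain ⟨k, rfl⟩ := Nat.exists_eq_add_of_lt hn
    rw [zero_add, pow_succ'] at hdeg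
    simpa using (Nat.eq_of_mul_eq_mul_left hp.pos hdeg).symm
  have hsurj := @IsCompositum.surjective_algebraMap F L F M _ _ _ _ _ _ algM _ algM' _ tower hcomp
    Function.surjective_id
  clear hcomp tower algM'
  have hL : FiniteDimensional F L := Module.finite_of_finrank_pos (by
    rw [hLd]; exact Nat.pos_of_mul_pos_left hd0)
  let ι : L ≃ₐ[F] M := AlgEquiv.ofBijective (IsScalarTower.toAlgHom F L M)
    ⟨(IsScalarTower.toAlgHom F L M).toRingHom.injective, hsurj⟩
  have : FiniteDimensional F M := ι.toLinearEquiv.finiteDimensional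
  have : Algebra.IsSeparable F M := .of_algHom F L ι.symm.toAlgHom
  have := hA.symbolLengthLE_of_isBrauerEquiv hexp.2.1 hC hAC
  rwa [← ι.toLinearEquiv.finrank_eq, hLd, hd'] at this
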